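/- arXiv:2311.11064 — 3 statements merged into one kernel-verified Lean document; each statement's English description precedes it below -/
import Mathlib

section
/- Under the Hecke-pair setup below, assume additionally that a(n) + a′(n) ≠ 0 for some n, and that there exist constants A, B, C, D > 0 such that for every u₀ with 0 < u₀ < π/2 and every w ∈ ℂ with |w − u₀| ≤ u₀/2 one has |f(−e^{−iw}/√(4N))| ≤ C u₀^{−(k+1/2)} e^{−A/u₀} and |f(e^{iw}/√(4N))| ≤ D u₀^{−(k+1/2)} e^{−B/u₀}. Then there exists d > 0 such that for arbitrarily large T the real-valued function t ↦ R(t) has at least d·√T sign changes in the interval [0, T]; equivalently, the number N₀(T) of zeros of odd order of t ↦ L(σ₀ + it) + L′(σ₀ + it) with 0 ≤ t ≤ T satisfies limsup_{T→∞} N₀(T)/√T > d. -/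
/-- The sum `f(z) = ∑_{n≥1} a(n) e^{2πinz}` attached to coefficients `a : ℕ → ℝ`. -/
noncomputable def heckeSum (a : ℕ → ℝ) (z : ℂ) : ℂ :=
  ∑' n : ℕ, (a (n + 1) : ℂ) * Complex.exp (2 * Real.pi * Complex.I * ((n : ℂ) + 1) * z)

open Real Set Filter Topology MeasureTheory

/-- The successive points at which a function that starts out nonnegative to the right of `0`
changes its weak sign. -/
noncomputable def signBoundary (g : ℝ → ℝ) : ℕ → ℝ
  | 0 => 0
  | n + 1 => sInf {t | signBoundary g n ≤ t ∧ (-1) ^ n * g t < 0}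

/-- The points beyond the `n`-th sign boundary at which the sign is the opposite one. -/
def oppositeSignSet (g : ℝ → ℝ) (n : ℕ) : Set ℝ :=
  {t | signBoundary g n ≤ t ∧ (-1) ^ n * g t < 0}

lemma bddBelow_oppositeSignSet (g : ℝ → ℝ) (n : ℕ) : BddBelow (oppositeSignSet g n) :=
  ⟨_, fun _ h => h.1⟩

lemma signBoundary_le_succ {g : ℝ → ℝ} {n : ℕ} (h : (oppositeSignSet g n).Nonempty) :
    signBoundary g n ≤ signBoundary g (n + 1) :=
  le_csInf h fun _ h => h.1

lemma signBoundary_mono {g : ℝ → ℝ} {m : ℕ} (h : ∀ j < m, (oppositeSignSet g j).Nonempty)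
    {i j : ℕ} (hij : i ≤ j) (hj : j ≤ m) : signBoundary g i ≤ signBoundary g j := by
  induction j, hij using Nat.le_induction with
  | base => exact le_rfl
  | succ j _ ih => exact (ih (by omega)).trans (signBoundary_le_succ (h j (by omega)))

lemma exists_mem_Ioo_signBoundary_succ {g : ℝ → ℝ} (hg : Continuous g) {n : ℕ}
    (h : (oppositeSignSet g n).Nonempty) {Y : ℝ} (hY : signBoundary g (n + 1) < Y) :
    ∃ p ∈ Ioo (signBoundary g (n + 1)) Y, 0 < (-1) ^ (n + 1) * g p := by
  obtain ⟨q, hq, hqY⟩ := exists_lt_of_csInf_lt h hY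
  have h1 : ∀ᶠ p in 𝓝[>] q, (-1) ^ n * g p < 0 :=
    ((continuous_const.mul hg).tendsto q |>.mono_left nhdsWithin_le_nhds).eventually_lt_const hq.2
  obtain ⟨p, hp, hpq⟩ := (h1.and (Ioo_mem_nhdsGT hqY)).exists
  refine ⟨p, ⟨(csInf_le (bddBelow_oppositeSignSet g n) hq).trans_lt hpq.1, hpq.2⟩, ?_⟩
  rw [pow_succ]; linarith

/-- Up to `n` sign boundaries produce a chain of `n` sign changes just beyond the last one. -/
lemma exists_alternating_of_signBoundary {g : ℝ → ℝ} (hg : Continuous g) {δ : ℝ} (hδ : 0 < δ)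
    (hpos : ∀ t ∈ Ioo 0 δ, 0 < g t) (n : ℕ) (h : ∀ j < n, (oppositeSignSet g j).Nonempty)
    {Y : ℝ} (hY : signBoundary g n < Y) :
    ∃ p : ℕ → ℝ, (∀ i < n, p i < p (i + 1)) ∧ signBoundary g n < p n ∧ p n < Y ∧
      (∀ i ≤ n, 0 < p i) ∧ ∀ i ≤ n, 0 < (-1) ^ i * g (p i) := by
  induction n generalizing Y with
  | zero =>
    simp only [signBoundary] at hY
    obtain ⟨c, hc, hc'⟩ := exists_between (lt_min hY hδ)
    refine ⟨fun _ => c, by simp, by simpa [signBoundary] using hc,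
      hc'.trans_le (min_le_left _ _), fun _ _ => hc, fun i hi => ?_⟩
    obtain rfl : i = 0 := by omega
    simpa using hpos c ⟨hc, hc'.trans_le (min_le_right _ _)⟩
  | succ n ih =>
    have hn := h n (by omega)
    obtain ⟨q, hq, hgq⟩ := exists_mem_Ioo_signBoundary_succ hg hn hY
    obtain ⟨p, hp1, -, hp2, hp3, hp4⟩ := ih (fun j hj => h j (by omega))
      ((signBoundary_le_succ hn).trans_lt hq.1)
    have hne : ∀ i ≤ n, i ≠ n + 1 := fun i hi => by omega
    have h0 : (0 : ℝ) < q := (hp3 n le_rfl).trans hp2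
    refine ⟨Function.update p (n + 1) q, fun i hi => ?_, by simpa using hq.1,
      by simpa using hq.2, fun i hi => ?_, fun i hi => ?_⟩
    · rw [Function.update_of_ne (hne i (by omega))]
      rcases Nat.lt_succ_iff_lt_or_eq.mp hi with hi | rfl
      · rw [Function.update_of_ne (hne _ hi)]; exact hp1 i hi
      · simpa using hp2
    · rcases Nat.le_succ_iff.mp hi with hi | rfl
      · rw [Function.update_of_ne (hne i hi)]; exact hp3 i hi
      · simpa using h0
    · rcases Nat.le_succ_iff.mp hi with hi | rfl
      · rw [Function.update_of_ne (hne i hi)]; exact hp4 i hi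
      · simpa using hgq

lemma le_signBoundary {g : ℝ → ℝ} (hg : Continuous g) {δ : ℝ} (hδ : 0 < δ)
    (hpos : ∀ t ∈ Ioo 0 δ, 0 < g t) {m : ℕ} (h : ∀ j < m, (oppositeSignSet g j).Nonempty)
    {j : ℕ} (hj : j < m) : δ ≤ signBoundary g (j + 1) := by
  have h1 : δ ≤ signBoundary g 1 := by
    refine le_csInf (h 0 (by omega)) fun t ht => ?_
    by_contra! hlt
    have hge : 0 ≤ t := by simpa [signBoundary] using ht.1
    have hneg : g t < 0 := by simpa using ht.2
    have : t ∈ closure (Ioo (0 : ℝ) δ) := by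
      rw [closure_Ioo hδ.ne]; exact ⟨hge, hlt.le⟩
    exact hneg.not_ge (closure_minimal (fun x hx => (hpos x hx).le)
      (isClosed_le continuous_const hg) this)
  exact h1.trans (signBoundary_mono h (by omega) hj)

lemma mul_prod_signBoundary_nonneg {g : ℝ → ℝ} {m : ℕ}
    (h : ∀ j < m, (oppositeSignSet g j).Nonempty) (hξ : ∀ j < m, 0 < signBoundary g (j + 1))
    {X : ℝ} (hX : ∀ t ∈ oppositeSignSet g m, X < t) {t : ℝ} (ht : t ∈ Icc 0 X) :
    0 ≤ g t * ∏ j ∈ Finset.range m, (1 - t ^ 2 / signBoundary g (j + 1) ^ 2) := by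
  have hbefore : ∀ n ≤ m, signBoundary g n ≤ t →
      0 ≤ (-1) ^ n * ∏ j ∈ Finset.range n, (1 - t ^ 2 / signBoundary g (j + 1) ^ 2) := by
    intro n hn hnt
    rw [← Finset.card_range n, ← Finset.prod_const, Finset.card_range, ← Finset.prod_mul_distrib]
    refine Finset.prod_nonneg fun j hj => ?_
    have hj' := Finset.mem_range.mp hj
    have h1 := (signBoundary_mono h (Nat.succ_le_of_lt hj') hn).trans hnt
    have h2 : 1 ≤ t ^ 2 / signBoundary g (j + 1) ^ 2 := by
      rw [one_le_div (pow_pos (hξ j (by omega)) 2)]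
      exact pow_le_pow_left₀ (hξ j (by omega)).le h1 2
    linarith
  have hmul : ∀ n ≤ m, signBoundary g n ≤ t → 0 ≤ (-1) ^ n * g t →
      0 ≤ g t * ∏ j ∈ Finset.range n, (1 - t ^ 2 / signBoundary g (j + 1) ^ 2) := by
    intro n hn hnt hgt
    have := mul_nonneg hgt (hbefore n hn hnt)
    have hs : ((-1 : ℝ) ^ n) * (-1) ^ n = 1 := by rw [← mul_pow]; simp
    calc (0 : ℝ) ≤ _ := this
      _ = ((-1 : ℝ) ^ n * (-1) ^ n) * (g t * ∏ j ∈ Finset.range n,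
          (1 - t ^ 2 / signBoundary g (j + 1) ^ 2)) := by ring
      _ = _ := by rw [hs, one_mul]
  have key : ∀ n ≤ m, t ≤ signBoundary g n →
      0 ≤ g t * ∏ j ∈ Finset.range n, (1 - t ^ 2 / signBoundary g (j + 1) ^ 2) := by
    intro n
    induction n with
    | zero =>
      intro _ h0
      obtain rfl : t = 0 := le_antisymm (by simpa [signBoundary] using h0) ht.1
      refine hmul 0 (by omega) (by simp [signBoundary]) ?_
      by_contra! hneg
      rcases Nat.eq_zero_or_pos m with rfl | hm
      · exact (hX 0 ⟨by simp [signBoundary], hneg⟩).not_ge ht.2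
      · have : signBoundary g 1 ≤ 0 :=
          csInf_le (bddBelow_oppositeSignSet g 0) ⟨by simp [signBoundary], hneg⟩
        exact (hξ 0 hm).not_ge this
    | succ n ih =>
      intro hn htn
      rcases htn.eq_or_lt with rfl | htn
      · rw [Finset.prod_range_succ, div_self (pow_pos (hξ n hn) 2).ne']; simp
      have hfac : 0 ≤ 1 - t ^ 2 / signBoundary g (n + 1) ^ 2 := by
        rw [sub_nonneg, div_le_one (pow_pos (hξ n hn) 2)]
        exact pow_le_pow_left₀ ht.1 htn.le 2
      rw [Finset.prod_range_succ, ← mul_assoc]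
      refine mul_nonneg ?_ hfac
      rcases le_total t (signBoundary g n) with hle | hge
      · exact ih (by omega) hle
      · refine hmul n (by omega) hge ?_
        by_contra! hneg
        exact htn.not_ge (csInf_le (bddBelow_oppositeSignSet g n) ⟨hge, hneg⟩)
  rcases le_total t (signBoundary g m) with hle | hge
  · exact key m le_rfl hle
  · refine hmul m le_rfl hge ?_
    by_contra! hneg
    exact (hX t ⟨hge, hneg⟩).not_ge ht.2

/-- `HasSignChanges g m T` says that `g` has at least `m` sign changes in `[0, T]`. -/
def HasSignChanges (g : ℝ → ℝ) (m : ℕ) (T : ℝ) : Prop :=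
  ∃ t : Fin (m + 1) → ℝ, StrictMono t ∧ (∀ i, t i ∈ Icc (0 : ℝ) T) ∧
    ∀ i : Fin m, g (t i.castSucc) * g (t i.succ) < 0

lemma hasSignChanges_of_lt {g : ℝ → ℝ} (hg : Continuous g) {δ : ℝ} (hδ : 0 < δ)
    (hpos : ∀ t ∈ Ioo 0 δ, 0 < g t) {n : ℕ} (h : ∀ j < n, (oppositeSignSet g j).Nonempty)
    {Y : ℝ} (hY : signBoundary g n < Y) : HasSignChanges g n Y := by
  obtain ⟨p, hp1, -, hp2, hp3, hp4⟩ := exists_alternating_of_signBoundary hg hδ hpos n h hY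
  have hmono : StrictMono fun i : Fin (n + 1) => p i :=
    Fin.strictMono_iff_lt_succ.mpr fun i => by simpa using hp1 i i.2
  refine ⟨_, hmono, fun i => ⟨(hp3 i (by omega)).le, ?_⟩, fun i => ?_⟩
  · have := hmono.monotone (Fin.le_last i)
    simp only [Fin.val_last] at this
    linarith
  · have h1 := mul_pos (hp4 i (by omega)) (hp4 (i + 1) (by omega))
    have hs : ((-1 : ℝ) ^ (i : ℕ)) * (-1) ^ (i : ℕ) = 1 := by rw [← mul_pow]; simp
    have h2 : (-1 : ℝ) ^ (i : ℕ) * g (p i) * ((-1) ^ ((i : ℕ) + 1) * g (p (i + 1))) =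
        -(((-1 : ℝ) ^ (i : ℕ)) * (-1) ^ (i : ℕ) * (g (p i) * g (p (i + 1)))) := by ring
    rw [h2, hs] at h1
    simp only [Fin.val_castSucc, Fin.val_succ]
    linarith

/-- If the number of sign changes in `[0, T]` is eventually less than `d √T`, then the sign of `g`
on `[0, X]` is that of a product over sign boundaries, which are sparse. -/
lemma exists_sparse_boundaries {g : ℝ → ℝ} (hg : Continuous g) {δ : ℝ} (hδ : 0 < δ)
    (hpos : ∀ t ∈ Ioo 0 δ, 0 < g t) {d T₀ : ℝ}
    (hfew : ∀ T, T₀ ≤ T → ∀ m : ℕ, HasSignChanges g m T → (m : ℝ) < d * √T) (X : ℝ) :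
    ∃ (m : ℕ) (ξ : ℕ → ℝ), (∀ j < m, δ ≤ ξ j) ∧
      (∀ j < m, (j + 1 : ℝ) ≤ d * √(max (ξ j) T₀)) ∧
      ∀ t ∈ Icc 0 X, 0 ≤ g t * ∏ j ∈ Finset.range m, (1 - t ^ 2 / ξ j ^ 2) := by
  classical
  have hex : ∃ n, ¬ ∃ t ∈ oppositeSignSet g n, t ≤ X := by
    by_contra! hall
    have hne : ∀ j, (oppositeSignSet g j).Nonempty := fun j => (hall j).imp fun _ h => h.1
    set Y := max (X + 1) T₀
    obtain ⟨n, hn⟩ := exists_nat_gt (d * √Y)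
    obtain ⟨t, ht, htX⟩ := hall n
    have hlt : signBoundary g n < Y :=
      (ht.1.trans htX).trans_lt ((lt_add_one X).trans_le (le_max_left _ _))
    exact (hfew Y (le_max_right _ _) n
      (hasSignChanges_of_lt hg hδ hpos (fun j _ => hne j) hlt)).not_gt hn
  set m := Nat.find hex
  have hne : ∀ j < m, (oppositeSignSet g j).Nonempty := fun j hj =>
    (not_not.mp (Nat.find_min hex hj)).imp fun _ h => h.1
  have hδξ : ∀ j < m, δ ≤ signBoundary g (j + 1) := fun j hj => le_signBoundary hg hδ hpos hne hj
  refine ⟨m, fun j => signBoundary g (j + 1), hδξ, fun j hj => ?_, fun t ht => ?_⟩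
  · have hev : ∀ᶠ Y in 𝓝[>] (max (signBoundary g (j + 1)) T₀), ((j + 1 : ℕ) : ℝ) ≤ d * √Y := by
      filter_upwards [self_mem_nhdsWithin] with Y hY
      have hY' := max_lt_iff.mp (mem_Ioi.mp hY)
      exact (hfew Y hY'.2.le _ (hasSignChanges_of_lt hg hδ hpos
        (fun i hi => hne i (by omega)) hY'.1)).le
    have hcont : Tendsto (fun Y => d * √Y) (𝓝[>] (max (signBoundary g (j + 1)) T₀))
        (𝓝 (d * √(max (signBoundary g (j + 1)) T₀))) :=
      ((continuous_const.mul Real.continuous_sqrt).tendsto _).mono_left nhdsWithin_le_nhds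
    simpa using ge_of_tendsto hcont hev
  · refine mul_prod_signBoundary_nonneg hne (fun j hj => hδ.trans_le (hδξ j hj)) (fun s hs => ?_) ht
    by_contra! hsX
    exact Nat.find_spec hex ⟨s, hs, hsX⟩

lemma prod_one_add_sq_div_le_exp {z : ℝ} (hz : 0 ≤ z) (m : ℕ) :
    ∏ j ∈ Finset.range m, (1 + z ^ 2 / ((j : ℝ) + 1) ^ 2) ≤ exp (π * z) := by
  rcases hz.eq_or_lt with rfl | hz
  · simp
  have hlim : Tendsto (fun n : ℕ => π * z * ∏ j ∈ Finset.range n, (1 + z ^ 2 / ((j : ℝ) + 1) ^ 2))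
      atTop (𝓝 (sinh (π * z))) := by
    have h := (Complex.continuous_im.tendsto _).comp
      (Complex.tendsto_euler_sin_prod ((z : ℂ) * Complex.I))
    rw [← mul_assoc, Complex.sin_mul_I] at h
    have h1 : (Complex.sinh (π * z) * Complex.I).im = sinh (π * z) := by
      rw [Complex.mul_I_im, ← Complex.ofReal_mul, Complex.sinh_ofReal_re]
    rw [h1] at h
    refine h.congr fun n => ?_
    have h2 : (π * z * Complex.I * ∏ j ∈ Finset.range n,
        (1 - (z * Complex.I) ^ 2 / ((j : ℂ) + 1) ^ 2) : ℂ) =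
        ((π * z * ∏ j ∈ Finset.range n, (1 + z ^ 2 / ((j : ℝ) + 1) ^ 2) : ℝ) : ℂ) * Complex.I := by
      push_cast
      simp only [mul_pow, Complex.I_sq]
      ring_nf
    rw [Function.comp_apply, h2, Complex.mul_I_im, Complex.ofReal_re]
  have hmono : Monotone fun n : ℕ =>
      π * z * ∏ j ∈ Finset.range n, (1 + z ^ 2 / ((j : ℝ) + 1) ^ 2) := by
    refine monotone_nat_of_le_succ fun n => ?_
    rw [Finset.prod_range_succ, ← mul_assoc]
    refine le_mul_of_one_le_right ?_ ?_
    · exact mul_nonneg (by positivity) (Finset.prod_nonneg fun j _ => by positivity)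
    · have : 0 ≤ z ^ 2 / ((n : ℝ) + 1) ^ 2 := by positivity
      linarith
  have hle := hmono.ge_of_tendsto hlim m
  have hx : 0 < π * z := by positivity
  have hsinh : sinh (π * z) ≤ π * z * exp (π * z) := by
    have h1 := add_one_le_exp (-2 * (π * z))
    have h2 : exp (-(π * z)) = exp (π * z) * exp (-2 * (π * z)) := by
      rw [← exp_add]; ring_nf
    rw [sinh_eq, h2]
    nlinarith [exp_pos (π * z)]
  exact le_of_mul_le_mul_left (hle.trans hsinh) hx

lemma prod_one_add_pow_four_div_le_exp {z : ℝ} (hz : 0 ≤ z) (m : ℕ) :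
    ∏ j ∈ Finset.range m, (1 + z ^ 4 / ((j : ℝ) + 1) ^ 4) ≤ exp (2 * π * z) := by
  calc ∏ j ∈ Finset.range m, (1 + z ^ 4 / ((j : ℝ) + 1) ^ 4)
      ≤ ∏ j ∈ Finset.range m, (1 + z ^ 2 / ((j : ℝ) + 1) ^ 2) ^ 2 := by
        refine Finset.prod_le_prod (fun j _ => by positivity) fun j _ => ?_
        have h : z ^ 4 / ((j : ℝ) + 1) ^ 4 = (z ^ 2 / ((j : ℝ) + 1) ^ 2) ^ 2 := by
          rw [div_pow]; ring_nf
        rw [h]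
        have : 0 ≤ z ^ 2 / ((j : ℝ) + 1) ^ 2 := by positivity
        nlinarith
    _ = (∏ j ∈ Finset.range m, (1 + z ^ 2 / ((j : ℝ) + 1) ^ 2)) ^ 2 := Finset.prod_pow _ _ _
    _ ≤ exp (π * z) ^ 2 := by
        refine pow_le_pow_left₀ (Finset.prod_nonneg fun j _ => by positivity)
          (prod_one_add_sq_div_le_exp hz m) 2
    _ = exp (2 * π * z) := by rw [← exp_nat_mul]; ring_nf

/-- A product over points of density `d √T` has growth `exp (2πd√y)`. -/
lemma exists_prod_one_add_le_exp {d δ T₀ : ℝ} (hd : 0 < d) (hδ : 0 < δ) (hδT : δ ≤ T₀) :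
    ∃ K : ℝ, 1 ≤ K ∧ ∀ (m : ℕ) (ξ : ℕ → ℝ), (∀ j < m, δ ≤ ξ j) →
      (∀ j < m, (j + 1 : ℝ) ≤ d * √(max (ξ j) T₀)) → ∀ y : ℝ, 0 ≤ y →
      ∏ j ∈ Finset.range m, (1 + y ^ 2 / ξ j ^ 2) ≤ K * exp (2 * π * d * √y) := by
  have hT₀ : 0 < T₀ := hδ.trans_le hδT
  set q := (T₀ / δ) ^ 2
  have hq : 1 ≤ q := one_le_pow₀ ((one_le_div hδ).mpr hδT)
  set J := ⌈d * √T₀⌉₊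
  refine ⟨q ^ J, one_le_pow₀ hq, fun m ξ hξ hξd y hy => ?_⟩
  set z := d * √y with hz
  have hz0 : 0 ≤ z := by positivity
  have hz4 : z ^ 4 = d ^ 4 * y ^ 2 := by
    rw [hz, mul_pow, show √y ^ 4 = (√y ^ 2) ^ 2 by ring, sq_sqrt hy]
  have hfac : ∀ j < m, 1 + y ^ 2 / ξ j ^ 2 ≤
      (if j < J then q else 1) * (1 + z ^ 4 / ((j : ℝ) + 1) ^ 4) := by
    intro j hj
    have hξj : 0 < ξ j := hδ.trans_le (hξ j hj)
    have hbound : ∀ s : ℝ, 0 < s → (j + 1 : ℝ) ≤ d * √s →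
        y ^ 2 / s ^ 2 ≤ z ^ 4 / ((j : ℝ) + 1) ^ 4 := by
      intro s hs hjs
      have h4 : ((j : ℝ) + 1) ^ 4 ≤ d ^ 4 * s ^ 2 := by
        calc ((j : ℝ) + 1) ^ 4 ≤ (d * √s) ^ 4 := pow_le_pow_left₀ (by positivity) hjs 4
          _ = d ^ 4 * s ^ 2 := by
            rw [mul_pow, show √s ^ 4 = (√s ^ 2) ^ 2 by ring, sq_sqrt hs.le]
      rw [hz4, div_le_div_iff₀ (by positivity) (by positivity)]
      nlinarith [sq_nonneg y]
    have hz' : 0 ≤ z ^ 4 / ((j : ℝ) + 1) ^ 4 := by positivity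
    rcases le_or_gt T₀ (ξ j) with hle | hlt
    · have h1 := hbound (ξ j) hξj (by simpa [max_eq_left hle] using hξd j hj)
      have h2 : 1 ≤ (if j < J then q else 1) := by split_ifs <;> simp [hq]
      nlinarith
    · have hjd : (j + 1 : ℝ) ≤ d * √T₀ := by simpa [max_eq_right hlt.le] using hξd j hj
      have hjJ : j < J := by
        have : ((j + 1 : ℕ) : ℝ) ≤ J := by push_cast; exact hjd.trans (Nat.le_ceil _)
        exact_mod_cast this
      rw [if_pos hjJ]
      have h1 := hbound T₀ hT₀ hjd
      have h2 : y ^ 2 / ξ j ^ 2 ≤ q * (y ^ 2 / T₀ ^ 2) := by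
        have : q * (y ^ 2 / T₀ ^ 2) = y ^ 2 / δ ^ 2 := by
          simp only [q]; field_simp
        rw [this]
        gcongr
        exact hξ j hj
      nlinarith
  calc ∏ j ∈ Finset.range m, (1 + y ^ 2 / ξ j ^ 2)
      ≤ ∏ j ∈ Finset.range m, ((if j < J then q else 1) * (1 + z ^ 4 / ((j : ℝ) + 1) ^ 4)) :=
        Finset.prod_le_prod (fun j _ => by positivity) fun j hj => hfac j (Finset.mem_range.mp hj)
    _ = (∏ j ∈ Finset.range m, if j < J then q else 1) *
          ∏ j ∈ Finset.range m, (1 + z ^ 4 / ((j : ℝ) + 1) ^ 4) := Finset.prod_mul_distrib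
    _ ≤ q ^ J * exp (2 * π * z) := by
        refine mul_le_mul ?_ (prod_one_add_pow_four_div_le_exp hz0 m)
          (Finset.prod_nonneg fun j _ => by positivity) (by positivity)
        rw [Finset.prod_ite, Finset.prod_const, Finset.prod_const_one, mul_one]
        refine pow_le_pow_right₀ hq ?_
        calc _ ≤ (Finset.range J).card := Finset.card_le_card fun j hj => by
              simp only [Finset.mem_filter, Finset.mem_range] at hj ⊢; exact hj.2
          _ = J := Finset.card_range J
    _ = q ^ J * exp (2 * π * d * √y) := by rw [hz]; ring_nf

lemma sum_le_prod_one_add {ι : Type*} (s : Finset ι) {f : ι → ℝ} (hf : ∀ i ∈ s, 0 ≤ f i) :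
    ∑ i ∈ s, f i ≤ ∏ i ∈ s, (1 + f i) := by
  classical
  suffices 1 + ∑ i ∈ s, f i ≤ ∏ i ∈ s, (1 + f i) by linarith
  induction s using Finset.induction_on with
  | empty => simp
  | insert a s ha ih =>
    rw [Finset.sum_insert ha, Finset.prod_insert ha]
    have h1 := ih fun i hi => hf i (Finset.mem_insert_of_mem hi)
    have h2 := Finset.sum_nonneg fun i hi => hf i (Finset.mem_insert_of_mem hi)
    nlinarith [hf a (Finset.mem_insert_self a s)]

lemma one_sub_sum_le_prod_one_sub {ι : Type*} (s : Finset ι) {f : ι → ℝ}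
    (hf : ∀ i ∈ s, 0 ≤ f i) (hf1 : ∀ i ∈ s, f i ≤ 1) :
    1 - ∑ i ∈ s, f i ≤ ∏ i ∈ s, (1 - f i) := by
  classical
  induction s using Finset.induction_on with
  | empty => simp
  | insert a s ha ih =>
    rw [Finset.sum_insert ha, Finset.prod_insert ha]
    have h1 := ih (fun i hi => hf i (Finset.mem_insert_of_mem hi))
      fun i hi => hf1 i (Finset.mem_insert_of_mem hi)
    have h2 := Finset.sum_nonneg fun i hi => hf i (Finset.mem_insert_of_mem hi)
    nlinarith [hf a (Finset.mem_insert_self a s), hf1 a (Finset.mem_insert_self a s)]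

/-- Continuous functions decaying like `exp (-κ|t|)` for every `κ < π/2`. -/
def RapidDecay {E : Type*} [NormedAddCommGroup E] (g : ℝ → E) : Prop :=
  Continuous g ∧ ∀ κ < π / 2, ∃ C, ∀ t, ‖g t‖ ≤ C * exp (-κ * |t|)

lemma integrable_exp_neg_mul_abs {c : ℝ} (hc : 0 < c) :
    Integrable fun t : ℝ => exp (-c * |t|) := by
  rw [← integrableOn_univ, ← Iic_union_Ioi (a := (0 : ℝ))]
  refine IntegrableOn.union ?_ ?_
  · refine (integrableOn_exp_mul_Iic hc 0).congr_fun (fun t ht => ?_) measurableSet_Iic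
    simp only [abs_of_nonpos (mem_Iic.mp ht)]; ring_nf
  · refine (integrableOn_exp_mul_Ioi (neg_lt_zero.mpr hc) 0).congr_fun (fun t ht => ?_)
      measurableSet_Ioi
    simp only [abs_of_pos (mem_Ioi.mp ht)]

lemma abs_pow_le_exp {η : ℝ} (hη : 0 < η) (n : ℕ) (t : ℝ) :
    |t| ^ n ≤ n.factorial / η ^ n * exp (η * |t|) := by
  have h := pow_div_factorial_le_exp (x := η * |t|) (by positivity) n
  rw [div_le_iff₀ (by positivity), mul_pow] at h
  rw [div_mul_eq_mul_div, le_div_iff₀ (by positivity)]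
  linarith

namespace RapidDecay

variable {E F : Type*} [NormedAddCommGroup E] [NormedAddCommGroup F]

lemma integrable_of_le {g : ℝ → E} (hg : RapidDecay g) {h : ℝ → F} (hh : Continuous h)
    {C η : ℝ} (hη : η < π / 2) (hle : ∀ t, ‖h t‖ ≤ C * exp (η * |t|) * ‖g t‖) :
    Integrable h := by
  obtain ⟨C', hC'⟩ := hg.2 ((η + π / 2) / 2) (by linarith)
  refine ((integrable_exp_neg_mul_abs (c := (π / 2 - η) / 2) (by linarith)).const_mul
    (|C| * C')).mono' hh.aestronglyMeasurable (ae_of_all _ fun t => ?_)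
  calc ‖h t‖ ≤ C * exp (η * |t|) * ‖g t‖ := hle t
    _ ≤ |C| * exp (η * |t|) * (C' * exp (-((η + π / 2) / 2) * |t|)) := by
        gcongr
        · exact le_abs_self C
        · exact hC' t
    _ = |C| * C' * (exp (η * |t|) * exp (-((η + π / 2) / 2) * |t|)) := by ring
    _ = _ := by rw [← exp_add]; ring_nf

lemma of_le {g : ℝ → E} (hg : RapidDecay g) {h : ℝ → F} (hh : Continuous h)
    (hle : ∀ η > 0, ∃ C, ∀ t, ‖h t‖ ≤ C * exp (η * |t|) * ‖g t‖) : RapidDecay h := by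
  refine ⟨hh, fun κ hκ => ?_⟩
  obtain ⟨C', hC'⟩ := hg.2 ((κ + π / 2) / 2) (by linarith)
  obtain ⟨C, hC⟩ := hle ((π / 2 - κ) / 2) (by linarith)
  refine ⟨|C| * C', fun t => ?_⟩
  calc ‖h t‖ ≤ C * exp ((π / 2 - κ) / 2 * |t|) * ‖g t‖ := hC t
    _ ≤ |C| * exp ((π / 2 - κ) / 2 * |t|) * (C' * exp (-((κ + π / 2) / 2) * |t|)) := by
        gcongr
        · exact le_abs_self C
        · exact hC' t
    _ = |C| * C' * (exp ((π / 2 - κ) / 2 * |t|) * exp (-((κ + π / 2) / 2) * |t|)) := by ring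
    _ = _ := by rw [← exp_add]; ring_nf

end RapidDecay

lemma exp_mul_le_exp_abs_mul_abs (c t : ℝ) : exp (c * t) ≤ exp (|c| * |t|) :=
  exp_le_exp.mpr ((le_abs_self _).trans (abs_mul c t).le)

section Moments

variable {r : ℝ → ℝ} {u : ℝ}

lemma RapidDecay.integrable_mul_pow_mul_exp (hr : RapidDecay r) {c : ℝ} (hc : |c| < π / 2)
    (n : ℕ) : Integrable fun t => r t * t ^ n * exp (c * t) := by
  set η := (π / 2 - |c|) / 2 with hη
  have hη0 : 0 < η := by linarith
  refine hr.integrable_of_le (C := n.factorial / η ^ n) (η := η + |c|)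
    ((hr.1.mul (continuous_pow n)).mul (by fun_prop)) (by linarith) fun t => ?_
  rw [norm_mul, norm_mul, norm_pow, norm_eq_abs t, norm_eq_abs (exp _), abs_exp, add_mul, exp_add]
  calc ‖r t‖ * |t| ^ n * exp (c * t)
      ≤ ‖r t‖ * (n.factorial / η ^ n * exp (η * |t|)) * exp (|c| * |t|) := by
        refine mul_le_mul (mul_le_mul_of_nonneg_left (abs_pow_le_exp hη0 n t) (norm_nonneg _))
          (exp_mul_le_exp_abs_mul_abs c t) (exp_pos _).le (by positivity)
    _ = _ := by ring

lemma integrableOn_pow_mul_exp_neg (v : ℝ) (n : ℕ) :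
    IntegrableOn (fun x : ℝ => (x * v) ^ n * exp (-x)) (Ioi 0) ∧
      ∫ x in Ioi (0 : ℝ), (x * v) ^ n * exp (-x) = n.factorial * v ^ n := by
  have h1 := Real.GammaIntegral_convergent (s := n + 1) (by positivity)
  have h2 : ∀ x : ℝ, (x * v) ^ n * exp (-x) = v ^ n * (exp (-x) * x ^ ((n : ℝ) + 1 - 1)) := by
    intro x
    rw [add_sub_cancel_right, rpow_natCast]; ring
  simp only [h2]
  refine ⟨h1.const_mul _, ?_⟩
  rw [integral_const_mul, ← Real.Gamma_eq_integral (by positivity), Real.Gamma_nat_eq_factorial]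
  ring

/-- Factorial moment bounds turn into a Laplace-type bound for integrals against
`∏ (1 - t²/ξ²)`. -/
lemma abs_integral_mul_prod_le (hr : RapidDecay r) {c : ℝ} (hc : |c| < π / 2) {K v : ℝ}
    (hmom : ∀ n : ℕ, |∫ t, r t * t ^ n * exp (c * t)| ≤ K * (n.factorial * v ^ n))
    (ξ : ℕ → ℝ) (m : ℕ) (n : ℕ) :
    Integrable (fun t => r t * (t ^ n * ∏ j ∈ Finset.range m, (1 - t ^ 2 / ξ j ^ 2)) *
        exp (c * t)) ∧
      IntegrableOn (fun x : ℝ => ((x * v) ^ n * ∏ j ∈ Finset.range m,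
        (1 + (x * v) ^ 2 / ξ j ^ 2)) * exp (-x)) (Ioi 0) ∧
      |∫ t, r t * (t ^ n * ∏ j ∈ Finset.range m, (1 - t ^ 2 / ξ j ^ 2)) * exp (c * t)| ≤
        K * ∫ x in Ioi (0 : ℝ), ((x * v) ^ n * ∏ j ∈ Finset.range m,
          (1 + (x * v) ^ 2 / ξ j ^ 2)) * exp (-x) := by
  induction m generalizing n with
  | zero =>
    simp only [Finset.range_zero, Finset.prod_empty, mul_one]
    exact ⟨hr.integrable_mul_pow_mul_exp hc n, (integrableOn_pow_mul_exp_neg v n).1,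
      by rw [(integrableOn_pow_mul_exp_neg v n).2]; exact hmom n⟩
  | succ m ih =>
    obtain ⟨h1, h2, h3⟩ := ih n
    obtain ⟨k1, k2, k3⟩ := ih (n + 2)
    have e1 : (fun t => r t * (t ^ n * ∏ j ∈ Finset.range (m + 1), (1 - t ^ 2 / ξ j ^ 2)) *
        exp (c * t)) = fun t =>
        r t * (t ^ n * ∏ j ∈ Finset.range m, (1 - t ^ 2 / ξ j ^ 2)) * exp (c * t) -
        (1 / ξ m ^ 2) *
          (r t * (t ^ (n + 2) * ∏ j ∈ Finset.range m, (1 - t ^ 2 / ξ j ^ 2)) * exp (c * t)) := by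
      funext t; rw [Finset.prod_range_succ]; ring
    have e2 : (fun x : ℝ => ((x * v) ^ n * ∏ j ∈ Finset.range (m + 1),
        (1 + (x * v) ^ 2 / ξ j ^ 2)) * exp (-x)) = fun x =>
        ((x * v) ^ n * ∏ j ∈ Finset.range m, (1 + (x * v) ^ 2 / ξ j ^ 2)) * exp (-x) +
        (1 / ξ m ^ 2) * (((x * v) ^ (n + 2) * ∏ j ∈ Finset.range m,
          (1 + (x * v) ^ 2 / ξ j ^ 2)) * exp (-x)) := by
      funext x; rw [Finset.prod_range_succ]; ring
    rw [e1, e2]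
    refine ⟨h1.sub (k1.const_mul _), h2.add (k2.const_mul _), ?_⟩
    rw [integral_sub h1 (k1.const_mul _), integral_add h2 (k2.const_mul _), integral_const_mul,
      integral_const_mul, mul_add]
    refine (abs_sub _ _).trans (add_le_add h3 ?_)
    rw [abs_mul, abs_of_nonneg (by positivity : (0 : ℝ) ≤ 1 / ξ m ^ 2)]
    calc _ ≤ 1 / ξ m ^ 2 * (K * _) := mul_le_mul_of_nonneg_left k3 (by positivity)
      _ = _ := by ring

end Moments

lemma mul_sqrt_le {a η x : ℝ} (hη : 0 < η) (hx : 0 ≤ x) :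
    a * √x ≤ η * x + a ^ 2 / (4 * η) := by
  have h1 := sq_sqrt hx
  have h2 : 0 ≤ (2 * η * √x - a) ^ 2 / (4 * η) := by positivity
  have h3 : (2 * η * √x - a) ^ 2 / (4 * η) = η * √x ^ 2 + a ^ 2 / (4 * η) - a * √x := by
    field_simp; ring
  rw [h3, h1] at h2
  linarith

lemma integral_prod_mul_exp_neg_le {K b v : ℝ} (hK : 0 ≤ K) (hv : 0 ≤ v) {f : ℝ → ℝ}
    (hfi : IntegrableOn (fun x => f x * exp (-x)) (Ioi 0))
    (hf : ∀ x, 0 < x → f x ≤ K * exp (b * √(x * v))) :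
    ∫ x in Ioi (0 : ℝ), f x * exp (-x) ≤ 2 * K * exp (b ^ 2 * v / 2) := by
  have hint : IntegrableOn (fun x : ℝ => exp (-(1 / 2) * x)) (Ioi 0) :=
    integrableOn_exp_mul_Ioi (by norm_num) 0
  have hval : ∫ x in Ioi (0 : ℝ), exp (-(1 / 2) * x) = 2 := by
    rw [integral_exp_mul_Ioi (by norm_num) 0]; norm_num
  calc ∫ x in Ioi (0 : ℝ), f x * exp (-x)
      ≤ ∫ x in Ioi (0 : ℝ), K * exp (b ^ 2 * v / 2) * exp (-(1 / 2) * x) := by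
        refine setIntegral_mono_on hfi (hint.const_mul _) measurableSet_Ioi fun x hx => ?_
        have hx' : 0 < x := hx
        have h1 : b * √(x * v) ≤ x / 2 + b ^ 2 * v / 2 := by
          rw [sqrt_mul hx'.le]
          have := mul_sqrt_le (a := b * √v) (η := 1 / 2) (by norm_num) hx'.le
          have h2 : (b * √v) ^ 2 = b ^ 2 * v := by rw [mul_pow, sq_sqrt hv]
          rw [h2] at this
          calc b * (√x * √v) = b * √v * √x := by ring
            _ ≤ _ := this
            _ = _ := by ring
        calc f x * exp (-x) ≤ K * exp (x / 2 + b ^ 2 * v / 2) * exp (-x) := by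
              gcongr
              exact (hf x hx').trans (by gcongr)
          _ = K * (exp (x / 2 + b ^ 2 * v / 2) * exp (-x)) := by ring
          _ = K * (exp (b ^ 2 * v / 2) * exp (-(1 / 2) * x)) := by
              rw [← exp_add, ← exp_add]; ring_nf
          _ = _ := by ring
    _ = 2 * K * exp (b ^ 2 * v / 2) := by
        rw [integral_const_mul, hval]; ring

lemma tendsto_integral_indicator_abs_gt {G : ℝ → ℝ} (hG : Integrable G) :
    Tendsto (fun X : ℝ => ∫ t, {t : ℝ | X < |t|}.indicator G t) atTop (𝓝 0) := by
  have hmeas : ∀ X : ℝ, MeasurableSet {t : ℝ | X < |t|} := fun X =>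
    measurableSet_lt measurable_const (by fun_prop)
  have h := tendsto_integral_filter_of_dominated_convergence (l := atTop)
    (F := fun (X : ℝ) t => {t : ℝ | X < |t|}.indicator G t) (f := fun _ => 0) (μ := volume)
    (fun t => ‖G t‖)
    (.of_forall fun X => hG.aestronglyMeasurable.indicator (hmeas X))
    (.of_forall fun X => ae_of_all _ fun t => norm_indicator_le_norm_self _ _) hG.norm
    (ae_of_all _ fun t => tendsto_const_nhds.congr' ?_)
  · simpa using h
  · filter_upwards [eventually_ge_atTop |t|] with X hX
    rw [indicator_of_notMem]
    simpa using hX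

lemma tendsto_rpow_neg_mul_exp_neg_div {A : ℝ} (hA : 0 < A) (α : ℝ) :
    Tendsto (fun u : ℝ => u ^ (-α) * exp (-A / u)) (𝓝[>] 0) (𝓝 0) := by
  refine ((tendsto_rpow_mul_exp_neg_mul_atTop_nhds_zero α A hA).comp
    tendsto_inv_nhdsGT_zero).congr' ?_
  filter_upwards [self_mem_nhdsWithin] with u hu
  rw [Function.comp_apply, inv_rpow (le_of_lt hu), rpow_neg (le_of_lt hu), div_eq_mul_inv]

/-- An even function with rapid decay, positive just to the right of `0`, whose exponential
moments near the edge of the strip are exponentially small, has many sign changes. -/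
theorem exists_hasSignChanges_of_moments {r : ℝ → ℝ} (hr : RapidDecay r)
    (heven : ∀ t, r (-t) = r t) {δ : ℝ} (hδ : 0 < δ) (hpos : ∀ t ∈ Ioo 0 δ, 0 < r t)
    {K α A d : ℝ} (hA : 0 < A) (hd : 0 < d) (hdA : 8 * π ^ 2 * d ^ 2 ≤ A)
    (hmom : ∀ u, 0 < u → u < π / 2 → ∀ n : ℕ, |∫ t, r t * t ^ n * exp ((π / 2 - u) * t)| ≤
      K * u ^ (-α) * exp (-A / u) * (n.factorial * (2 / u) ^ n)) (T₀ : ℝ) :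
    ∃ T, T₀ ≤ T ∧ ∃ m : ℕ, d * √T ≤ m ∧ HasSignChanges r m T := by
  by_contra! hcon
  set T₁ := max T₀ δ
  obtain ⟨C, hC1, hC⟩ := exists_prod_one_add_le_exp hd hδ (le_max_right T₀ δ)
  have hfew : ∀ T, T₁ ≤ T → ∀ m : ℕ, HasSignChanges r m T → (m : ℝ) < d * √T := by
    intro T hT m hm
    by_contra! hle
    exact hcon T ((le_max_left _ _).trans hT) m hle hm
  set S := C * exp (2 * π * d) with hS
  have hS1 : 1 ≤ S := one_le_mul_of_one_le_of_one_le hC1 (one_le_exp (by positivity))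
  set ε := min δ (1 / (2 * S))
  have hε : 0 < ε := lt_min hδ (by positivity)
  have hεS : ε * S ≤ 1 / 2 := by
    have : ε ≤ 1 / (2 * S) := min_le_right _ _
    calc ε * S ≤ 1 / (2 * S) * S := by gcongr
      _ = 1 / 2 := by field_simp
  have hrint : Integrable r := by
    simpa using hr.integrable_mul_pow_mul_exp (c := 0) (by simp [pi_pos]) 0
  set c₀ := ∫ t in Ioo 0 ε, r t / 2 with hc₀
  have hc₀pos : 0 < c₀ := by
    rw [hc₀, setIntegral_pos_iff_support_of_nonneg_ae]
    · refine lt_of_lt_of_le ?_ (measure_mono (s := Ioo 0 ε) fun t ht =>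
        ⟨(half_pos (hpos t ⟨ht.1, ht.2.trans_le (min_le_left _ _)⟩)).ne', ht⟩)
      simpa using hε
    · filter_upwards [ae_restrict_mem measurableSet_Ioo] with t ht
      exact (half_pos (hpos t ⟨ht.1, ht.2.trans_le (min_le_left _ _)⟩)).le
    · exact (hrint.div_const 2).integrableOn
  have hmain : ∀ u, 0 < u → u < π / 2 →
      c₀ ≤ 2 * C * K * (u ^ (-α) * exp (-(A / 2) / u)) := by
    intro u hu hu2
    set c := π / 2 - u with hcdef
    have hc0 : 0 < c := by linarith
    have hcabs : |c| < π / 2 := by rw [abs_of_pos hc0]; linarith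
    set G : ℝ → ℝ := fun t => |r t| * (C * exp (2 * π * d * √|t|)) * exp (c * t) with hG
    have hGcont : Continuous G :=
      ((continuous_abs.comp hr.1).mul (by fun_prop)).mul (by fun_prop)
    have hGint : Integrable G := by
      refine hr.integrable_of_le (C := C * exp ((2 * π * d) ^ 2 / (4 * (u / 2))))
        (η := π / 2 - u / 2) hGcont (by linarith) fun t => ?_
      have h1 := mul_sqrt_le (a := 2 * π * d) (η := u / 2) (by linarith) (abs_nonneg t)
      have h2 : c * t ≤ c * |t| := mul_le_mul_of_nonneg_left (le_abs_self t) hc0.le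
      rw [norm_of_nonneg (by positivity : 0 ≤ G t), norm_eq_abs]
      calc G t = C * exp (2 * π * d * √|t| + c * t) * |r t| := by rw [exp_add, hG]; ring
        _ ≤ C * exp ((2 * π * d) ^ 2 / (4 * (u / 2)) + (π / 2 - u / 2) * |t|) * |r t| := by
            refine mul_le_mul_of_nonneg_right (mul_le_mul_of_nonneg_left (exp_le_exp.mpr ?_)
              (by positivity)) (abs_nonneg _)
            rw [hcdef] at h2 ⊢
            linarith
        _ = _ := by rw [exp_add]; ring
    have hKn : 0 ≤ K * u ^ (-α) * exp (-A / u) := by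
      simpa using (abs_nonneg _).trans (hmom u hu hu2 0)
    have hX : ∀ X, ε ≤ X → c₀ - ∫ t, {t : ℝ | X < |t|}.indicator G t ≤
        2 * C * K * (u ^ (-α) * exp (-(A / 2) / u)) := by
      intro X hX
      obtain ⟨m, ξ, hξδ, hξd, hsign⟩ := exists_sparse_boundaries hr.1 hδ hpos hfew X
      have hprod := hC m ξ hξδ hξd
      obtain ⟨hi1, hi2, hi3⟩ := abs_integral_mul_prod_le hr hcabs (v := 2 / u)
        (hmom u hu hu2) ξ m 0
      simp only [pow_zero, one_mul] at hi1 hi2 hi3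
      set P : ℝ → ℝ := fun t => ∏ j ∈ Finset.range m, (1 - t ^ 2 / ξ j ^ 2) with hP
      have hPeven : ∀ t, P |t| = P t := fun t => by simp only [hP, sq_abs]
      have hPabs : ∀ t, |P t| ≤ C * exp (2 * π * d * √|t|) := by
        intro t
        refine le_trans ?_ (hprod |t| (abs_nonneg t))
        rw [hP, Finset.abs_prod]
        refine Finset.prod_le_prod (fun _ _ => abs_nonneg _) fun j _ => ?_
        rw [sq_abs]
        refine (abs_sub _ _).trans ?_
        rw [abs_one, abs_of_nonneg (by positivity)]
      have hPhalf : ∀ t ∈ Ioo 0 ε, 1 / 2 ≤ P t := by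
        intro t ht
        have hsum : ∑ j ∈ Finset.range m, t ^ 2 / ξ j ^ 2 ≤ 1 / 2 := by
          have h1 : ∑ j ∈ Finset.range m, 1 ^ 2 / ξ j ^ 2 ≤ S :=
            (sum_le_prod_one_add _ fun j _ => by positivity).trans
              (by simpa [hS] using hprod 1 zero_le_one)
          have h2 : ∑ j ∈ Finset.range m, t ^ 2 / ξ j ^ 2 =
              t ^ 2 * ∑ j ∈ Finset.range m, 1 ^ 2 / ξ j ^ 2 := by
            rw [Finset.mul_sum]; refine Finset.sum_congr rfl fun j _ => by ring
          have hεle : ε ≤ 1 / 2 := by nlinarith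
          rw [h2]
          calc t ^ 2 * _ ≤ t ^ 2 * S := by gcongr
            _ ≤ ε ^ 2 * S := by gcongr; exacts [ht.1.le, ht.2.le]
            _ = ε * (ε * S) := by ring
            _ ≤ 1 / 2 := by nlinarith
        have := one_sub_sum_le_prod_one_sub (Finset.range m) (f := fun j => t ^ 2 / ξ j ^ 2)
          (fun j _ => by positivity) fun j hj => by
            refine (Finset.single_le_sum (f := fun j => t ^ 2 / ξ j ^ 2)
              (fun j _ => by positivity) hj).trans (hsum.trans (by norm_num))
        simp only [hP]
        linarith
      have hpt : ∀ t, (Ioo 0 ε).indicator (fun t => r t / 2) t -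
          {t : ℝ | X < |t|}.indicator G t ≤ r t * P t * exp (c * t) := by
        intro t
        by_cases htX : X < |t|
        · have htn : t ∉ Ioo 0 ε := fun ht => by
            rw [abs_of_pos ht.1] at htX; linarith [ht.2]
          rw [indicator_of_notMem htn, indicator_of_mem (by exact htX), zero_sub, neg_le]
          have h1 : |r t * P t| ≤ |r t| * (C * exp (2 * π * d * √|t|)) := by
            rw [abs_mul]; gcongr; exact hPabs t
          rw [← neg_mul, hG]
          exact mul_le_mul_of_nonneg_right ((neg_le_abs _).trans h1) (exp_pos _).le
        · rw [indicator_of_notMem (s := {t : ℝ | X < |t|}) (by exact htX), sub_zero]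
          have hnn : 0 ≤ r t * P t := by
            have h1 := hsign |t| ⟨abs_nonneg t, not_lt.mp htX⟩
            have h2 : r |t| = r t := by
              rcases abs_choice t with h | h <;> rw [h]; exact heven t
            rw [h2] at h1
            rw [← hPeven t]
            exact h1
          by_cases ht : t ∈ Ioo 0 ε
          · rw [indicator_of_mem ht]
            have h1 := hPhalf t ht
            have h2 := hpos t ⟨ht.1, ht.2.trans_le (min_le_left _ _)⟩
            have h3 : 1 ≤ exp (c * t) := one_le_exp (mul_pos hc0 ht.1).le
            nlinarith
          · rw [indicator_of_notMem ht]
            positivity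
      have hJ : Integrable ((Ioo 0 ε).indicator fun t => r t / 2) :=
        (hrint.div_const 2).indicator measurableSet_Ioo
      have hT : Integrable ({t : ℝ | X < |t|}.indicator G) :=
        hGint.indicator (measurableSet_lt measurable_const (by fun_prop))
      calc c₀ - ∫ t, {t : ℝ | X < |t|}.indicator G t
          = ∫ t, ((Ioo 0 ε).indicator (fun t => r t / 2) t - {t : ℝ | X < |t|}.indicator G t) := by
            rw [integral_sub hJ hT, integral_indicator measurableSet_Ioo]
        _ ≤ ∫ t, r t * P t * exp (c * t) := integral_mono (hJ.sub hT) hi1 hpt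
        _ ≤ _ := le_abs_self _
        _ ≤ _ := hi3
        _ ≤ K * u ^ (-α) * exp (-A / u) * (2 * C * exp ((2 * π * d) ^ 2 * (2 / u) / 2)) := by
            refine mul_le_mul_of_nonneg_left (integral_prod_mul_exp_neg_le (by positivity)
              (by positivity) hi2 fun x hx => ?_) hKn
            exact hprod (x * (2 / u)) (by positivity)
        _ ≤ K * u ^ (-α) * exp (-A / u) * (2 * C * exp ((A / 2) / u)) := by
            refine mul_le_mul_of_nonneg_left ?_ hKn
            have : (2 * π * d) ^ 2 * (2 / u) / 2 ≤ (A / 2) / u := by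
              rw [div_le_div_iff₀ (by norm_num) hu, mul_assoc, div_mul_cancel₀ _ hu.ne']
              nlinarith
            gcongr
        _ = 2 * C * K * (u ^ (-α) * (exp (-A / u) * exp ((A / 2) / u))) := by ring
        _ = _ := by rw [← exp_add]; ring_nf
    refine le_of_tendsto (f := fun X => c₀ - ∫ t, {t : ℝ | X < |t|}.indicator G t) (x := atTop) ?_
      (eventually_ge_atTop ε |>.mono hX)
    simpa using tendsto_const_nhds.sub (tendsto_integral_indicator_abs_gt hGint)
  have hlim : Tendsto (fun u : ℝ => 2 * C * K * (u ^ (-α) * exp (-(A / 2) / u))) (𝓝[>] 0) (𝓝 0) := by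
    simpa using (tendsto_rpow_neg_mul_exp_neg_div (half_pos hA) α).const_mul (2 * C * K)
  refine hc₀pos.not_ge (ge_of_tendsto hlim ?_)
  filter_upwards [Ioo_mem_nhdsGT (by positivity : (0 : ℝ) < π / 2)] with u hu
  exact hmain u hu.1 hu.2

/-- The exponential transform `φ ↦ ∫ g(t) e^{φt} dt`. -/
noncomputable def expTransform (g : ℝ → ℂ) (φ : ℂ) : ℂ := ∫ t : ℝ, g t * Complex.exp (φ * t)

lemma RapidDecay.mul_id {g : ℝ → ℂ} (hg : RapidDecay g) : RapidDecay fun t => g t * t := by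
  refine hg.of_le (hg.1.mul Complex.continuous_ofReal) fun η hη => ⟨1 / η, fun t => ?_⟩
  have h := abs_pow_le_exp hη 1 t
  rw [norm_mul, Complex.norm_real, norm_eq_abs, mul_comm]
  gcongr
  simpa using h

lemma RapidDecay.mul_pow {g : ℝ → ℂ} (hg : RapidDecay g) (n : ℕ) :
    RapidDecay fun t => g t * t ^ n := by
  induction n with
  | zero => simpa using hg
  | succ n ih => simpa only [pow_succ, mul_assoc] using ih.mul_id

lemma norm_cexp_mul_ofReal_le (φ : ℂ) (t : ℝ) :
    ‖Complex.exp (φ * t)‖ ≤ exp (|φ.re| * |t|) := by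
  rw [Complex.norm_exp, Complex.re_mul_ofReal]
  exact exp_mul_le_exp_abs_mul_abs _ _

lemma RapidDecay.integrable_mul_cexp {g : ℝ → ℂ} (hg : RapidDecay g) {φ : ℂ}
    (hφ : |φ.re| < π / 2) : Integrable fun t : ℝ => g t * Complex.exp (φ * t) := by
  refine hg.integrable_of_le (C := 1) (η := |φ.re|) (hg.1.mul (by fun_prop)) hφ fun t => ?_
  rw [norm_mul, mul_comm, one_mul]
  gcongr
  exact norm_cexp_mul_ofReal_le φ t

lemma isOpen_strip : IsOpen {φ : ℂ | |φ.re| < π / 2} :=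
  isOpen_lt (by fun_prop) continuous_const

lemma RapidDecay.hasDerivAt_expTransform {g : ℝ → ℂ} (hg : RapidDecay g) {φ : ℂ}
    (hφ : |φ.re| < π / 2) :
    HasDerivAt (expTransform g) (expTransform (fun t => g t * t) φ) φ := by
  set η := (π / 2 - |φ.re|) / 2 with hη
  have hη0 : 0 < η := by linarith
  have hg' := hg.mul_id
  have hball : ∀ ψ ∈ Metric.ball φ η, |ψ.re| ≤ |φ.re| + η := by
    intro ψ hψ
    have h1 : |(ψ - φ).re| ≤ ‖ψ - φ‖ := Complex.abs_re_le_norm _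
    have h2 : ‖ψ - φ‖ < η := by simpa [dist_eq_norm] using hψ
    have h3 : |ψ.re| ≤ |φ.re| + |(ψ - φ).re| := by
      simpa using abs_add_le φ.re (ψ - φ).re
    linarith
  refine (hasDerivAt_integral_of_dominated_loc_of_deriv_le (Metric.ball_mem_nhds φ hη0)
    (F := fun ψ t => g t * Complex.exp (ψ * t))
    (F' := fun ψ t => g t * t * Complex.exp (ψ * t))
    (bound := fun t => ‖g t * t‖ * exp ((|φ.re| + η) * |t|))
    (.of_forall fun ψ => (hg.1.mul (by fun_prop)).aestronglyMeasurable)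
    (hg.integrable_mul_cexp hφ) (hg'.1.mul (by fun_prop)).aestronglyMeasurable
    (ae_of_all _ fun t ψ hψ => ?_) ?_ (ae_of_all _ fun t ψ _ => ?_)).2
  · rw [norm_mul]
    gcongr
    refine (norm_cexp_mul_ofReal_le ψ t).trans (exp_le_exp.mpr ?_)
    exact mul_le_mul_of_nonneg_right (hball ψ hψ) (abs_nonneg t)
  · refine hg'.integrable_of_le (C := 1) (η := |φ.re| + η)
      (hg'.1.norm.mul (by fun_prop)) (by linarith) fun t => ?_
    rw [norm_mul, norm_norm, norm_of_nonneg (exp_pos _).le, one_mul, mul_comm]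
  · have h := (((hasDerivAt_id ψ).mul_const (t : ℂ)).cexp).const_mul (g t)
    simp only [id, one_mul] at h
    exact h.congr_deriv (by ring)

lemma RapidDecay.iteratedDeriv_expTransform {g : ℝ → ℂ} (hg : RapidDecay g) (n : ℕ) {φ : ℂ}
    (hφ : |φ.re| < π / 2) :
    iteratedDeriv n (expTransform g) φ = expTransform (fun t => g t * t ^ n) φ := by
  induction n generalizing φ with
  | zero => simp
  | succ n ih =>
    have hev : iteratedDeriv n (expTransform g) =ᶠ[𝓝 φ]
        expTransform (fun t => g t * t ^ n) :=
      (isOpen_strip.eventually_mem hφ).mono fun ψ hψ => ih hψ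
    rw [iteratedDeriv_succ, hev.deriv_eq, ((hg.mul_pow n).hasDerivAt_expTransform hφ).deriv]
    simp only [pow_succ, mul_assoc]

lemma RapidDecay.differentiableOn_expTransform {g : ℝ → ℂ} (hg : RapidDecay g) :
    DifferentiableOn ℂ (expTransform g) {φ : ℂ | |φ.re| < π / 2} := fun _ hφ =>
  (hg.hasDerivAt_expTransform hφ).differentiableAt.differentiableWithinAt

/-- Cauchy estimates for the moments of a rapidly decaying function. -/
lemma RapidDecay.abs_integral_re_mul_pow_le {g : ℝ → ℂ} (hg : RapidDecay g) {u M : ℝ} (hu : 0 < u)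
    (hu2 : u < π / 2)
    (hM : ∀ w : ℂ, ‖w - u‖ ≤ u / 2 → ‖expTransform g (π / 2 - w)‖ ≤ M) (n : ℕ) :
    |∫ t, (g t).re * t ^ n * exp ((π / 2 - u) * t)| ≤ M * (n.factorial * (2 / u) ^ n) := by
  set φ : ℂ := ((π / 2 - u : ℝ) : ℂ) with hφdef
  have hφre : φ.re = π / 2 - u := Complex.ofReal_re _
  have hφ : |φ.re| < π / 2 := by rw [hφre, abs_of_pos (by linarith)]; linarith
  have hclosed : ∀ ψ ∈ Metric.closedBall φ (u / 2), |ψ.re| < π / 2 := by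
    intro ψ hψ
    have h1 : |(ψ - φ).re| ≤ ‖ψ - φ‖ := Complex.abs_re_le_norm _
    have h2 : ‖ψ - φ‖ ≤ u / 2 := by simpa [dist_eq_norm] using hψ
    have h3 : |ψ.re| ≤ |φ.re| + |(ψ - φ).re| := by
      simpa using abs_add_le φ.re (ψ - φ).re
    rw [hφre, abs_of_pos (by linarith : 0 < π / 2 - u)] at h3
    linarith
  have hdiff : DiffContOnCl ℂ (expTransform g) (Metric.ball φ (u / 2)) :=
    DifferentiableOn.diffContOnCl (hg.differentiableOn_expTransform.mono fun ψ hψ =>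
      hclosed ψ (Metric.closure_ball_subset_closedBall hψ))
  have hsphere : ∀ ψ ∈ Metric.sphere φ (u / 2), ‖expTransform g ψ‖ ≤ M := by
    intro ψ hψ
    have h1 : ‖(π / 2 - ψ) - (u : ℂ)‖ ≤ u / 2 := by
      have h2 : ‖ψ - φ‖ = u / 2 := by simpa [dist_eq_norm] using hψ
      rw [← h2, ← norm_neg, hφdef]
      refine le_of_eq (congrArg _ ?_)
      push_cast; ring
    simpa using hM _ h1
  have hcauchy := Complex.norm_iteratedDeriv_le_of_forall_mem_sphere_norm_le n (half_pos hu)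
    hdiff hsphere
  rw [hg.iteratedDeriv_expTransform n hφ] at hcauchy
  have hre : ∫ t, (g t).re * t ^ n * exp ((π / 2 - u) * t) =
      (expTransform (fun t => g t * t ^ n) φ).re := by
    rw [expTransform, ← RCLike.re_eq_complex_re,
      ← integral_re ((hg.mul_pow n).integrable_mul_cexp hφ)]
    refine integral_congr_ae (ae_of_all _ fun t => ?_)
    simp only [RCLike.re_eq_complex_re, hφdef]
    rw [← Complex.ofReal_mul, ← Complex.ofReal_exp, ← Complex.ofReal_pow, Complex.re_mul_ofReal,
      Complex.re_mul_ofReal]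
  rw [hre]
  refine (Complex.abs_re_le_norm _).trans (hcauchy.trans (le_of_eq ?_))
  rw [div_pow, div_pow]
  field_simp

/-- The integral of an entire function along a vertical line does not depend on the line, under
uniform exponential decay. -/
lemma integral_vertical_eq {h : ℂ → ℂ} (hh : Differentiable ℂ h) {σ₁ σ₂ C κ : ℝ} (hκ : 0 < κ)
    (hb : ∀ σ ∈ uIcc σ₁ σ₂, ∀ t : ℝ, ‖h (σ + t * Complex.I)‖ ≤ C * exp (-κ * |t|)) :
    ∫ t : ℝ, h (σ₁ + t * Complex.I) = ∫ t : ℝ, h (σ₂ + t * Complex.I) := by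
  have hint : ∀ σ ∈ uIcc σ₁ σ₂, Integrable fun t : ℝ => h (σ + t * Complex.I) := fun σ hσ =>
    ((integrable_exp_neg_mul_abs hκ).const_mul C).mono'
      (hh.continuous.comp (by fun_prop)).aestronglyMeasurable (ae_of_all _ (hb σ hσ))
  have hdecay : Tendsto (fun T : ℝ => C * exp (-κ * |T|)) atTop (𝓝 0) := by
    have h1 : Tendsto (fun T : ℝ => exp (-κ * T)) atTop (𝓝 0) :=
      tendsto_exp_atBot.comp (tendsto_id.const_mul_atTop_of_neg (neg_lt_zero.mpr hκ))
    have h2 := h1.const_mul C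
    rw [mul_zero] at h2
    refine h2.congr' ?_
    filter_upwards [eventually_ge_atTop 0] with T hT
    rw [abs_of_nonneg hT]
  have hedge : ∀ s : ℝ, |s| = 1 → Tendsto
      (fun T : ℝ => ∫ x in σ₁..σ₂, h (x + ((s * T : ℝ) : ℂ) * Complex.I)) atTop (𝓝 0) := by
    intro s hs
    have h2 := hdecay.mul_const |σ₂ - σ₁|
    rw [zero_mul] at h2
    refine squeeze_zero_norm (fun T => ?_) h2
    refine intervalIntegral.norm_integral_le_of_norm_le_const fun x hx => ?_
    have := hb x (uIoc_subset_uIcc hx) (s * T)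
    rwa [abs_mul, hs, one_mul] at this
  have hlim : ∀ σ ∈ uIcc σ₁ σ₂, Tendsto (fun T : ℝ => ∫ t in (-T)..T, h (σ + t * Complex.I)) atTop
      (𝓝 (∫ t : ℝ, h (σ + t * Complex.I))) := fun σ hσ =>
    intervalIntegral_tendsto_integral (hint σ hσ) tendsto_neg_atTop_atBot tendsto_id
  have hrect : ∀ T : ℝ, (∫ t in (-T)..T, h (σ₂ + t * Complex.I)) -
      (∫ t in (-T)..T, h (σ₁ + t * Complex.I)) =
      Complex.I * ((∫ x in σ₁..σ₂, h (x + ((-1 * T : ℝ) : ℂ) * Complex.I)) -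
        ∫ x in σ₁..σ₂, h (x + ((1 * T : ℝ) : ℂ) * Complex.I)) := by
    intro T
    have h1 := Complex.integral_boundary_rect_eq_zero_of_differentiableOn h
      (⟨σ₁, -T⟩ : ℂ) ⟨σ₂, T⟩ hh.differentiableOn
    simp only [smul_eq_mul] at h1
    simp only [neg_one_mul, one_mul]
    linear_combination (-Complex.I) * h1 + ((∫ t in (-T)..T, h (σ₁ + t * Complex.I)) -
      (∫ t in (-T)..T, h (σ₂ + t * Complex.I))) * (-Complex.I_mul_I)
  have hl := ((hlim σ₂ right_mem_uIcc).sub (hlim σ₁ left_mem_uIcc))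
  have hr := ((hedge (-1) (by simp)).sub (hedge 1 (by simp))).const_mul Complex.I
  simp only [hrect] at hl
  have := tendsto_nhds_unique hl hr
  rw [sub_zero, mul_zero, sub_eq_zero] at this
  exact this.symm

lemma exists_one_add_rpow_le_exp (b : ℝ) {ε : ℝ} (hε : 0 < ε) :
    ∃ K, 0 < K ∧ ∀ x : ℝ, 0 ≤ x → (1 + x) ^ b ≤ K * exp (ε * x) := by
  set η := min 1 (ε / (|b| + 1))
  have hη : 0 < η := lt_min one_pos (by positivity)
  refine ⟨(1 / η) ^ |b|, by positivity, fun x hx => ?_⟩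
  have h1 : 1 + x ≤ 1 / η * exp (η * x) := by
    have h2 := add_one_le_exp (η * x)
    rw [div_mul_eq_mul_div, one_mul, le_div_iff₀ hη]
    have : η ≤ 1 := min_le_left _ _
    nlinarith
  have h3 : η * |b| ≤ ε := by
    calc η * |b| ≤ ε / (|b| + 1) * (|b| + 1) := by
          gcongr
          · exact min_le_right _ _
          · linarith
      _ = ε := by field_simp
  calc (1 + x) ^ b ≤ (1 + x) ^ |b| := rpow_le_rpow_of_exponent_le (by linarith) (le_abs_self b)
    _ ≤ (1 / η * exp (η * x)) ^ |b| := by gcongr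
    _ = (1 / η) ^ |b| * exp (η * |b| * x) := by
        rw [mul_rpow (by positivity) (exp_pos _).le, ← exp_mul]; ring_nf
    _ ≤ (1 / η) ^ |b| * exp (ε * x) := by gcongr

/-- The strip bound `O((1+|t|)^B e^{-π|t|/2})` gives any exponential rate below `π/2`. -/
lemma exists_strip_exp_bound {Λ : ℂ → ℂ} {σ₁ σ₂ C' B' : ℝ}
    (hstrip : ∀ σ t : ℝ, σ₁ ≤ σ → σ ≤ σ₂ →
      ‖Λ (σ + t * Complex.I)‖ ≤ C' * (1 + |t|) ^ B' * exp (-π * |t| / 2))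
    {κ : ℝ} (hκ : κ < π / 2) :
    ∃ C, ∀ σ ∈ Icc σ₁ σ₂, ∀ t : ℝ, ‖Λ (σ + t * Complex.I)‖ ≤ C * exp (-κ * |t|) := by
  obtain ⟨K, hK, hKb⟩ := exists_one_add_rpow_le_exp B' (sub_pos.mpr hκ)
  refine ⟨|C'| * K, fun σ hσ t => (hstrip σ t hσ.1 hσ.2).trans ?_⟩
  calc C' * (1 + |t|) ^ B' * exp (-π * |t| / 2)
      ≤ |C'| * (K * exp ((π / 2 - κ) * |t|)) * exp (-π * |t| / 2) := by
        gcongr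
        · exact le_abs_self C'
        · exact hKb |t| (abs_nonneg t)
    _ = |C'| * K * (exp ((π / 2 - κ) * |t|) * exp (-π * |t| / 2)) := by ring
    _ = _ := by rw [← exp_add]; ring_nf

lemma summable_rpow_mul_exp_neg (b : ℝ) {c : ℝ} (hc : 0 < c) :
    Summable fun n : ℕ => ((n : ℝ) + 1) ^ b * exp (-c * (n + 1)) := by
  have h1 := (summable_nat_add_iff 1).mpr (Real.summable_pow_mul_exp_neg_nat_mul ⌈b⌉₊ hc)
  refine Summable.of_nonneg_of_le (fun n => by positivity) (fun n => ?_) h1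
  push_cast
  gcongr
  rw [← rpow_natCast]
  exact rpow_le_rpow_of_exponent_le (by linarith [n.cast_nonneg (α := ℝ)]) (Nat.le_ceil b)

lemma norm_heckeSum_term_le {a : ℕ → ℝ} {C β : ℝ} (ha : ∀ n : ℕ, |a n| ≤ C * (n : ℝ) ^ β)
    (n : ℕ) (z : ℂ) :
    ‖(a (n + 1) : ℂ) * Complex.exp (2 * π * Complex.I * ((n : ℂ) + 1) * z)‖ ≤
      C * (((n : ℝ) + 1) ^ β * exp (-(2 * π * z.im) * (n + 1))) := by
  rw [norm_mul, Complex.norm_real, Complex.norm_exp, norm_eq_abs, ← mul_assoc]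
  have h1 := ha (n + 1)
  push_cast at h1
  have h2 : (2 * π * Complex.I * ((n : ℂ) + 1) * z).re = -(2 * π * z.im) * (n + 1) := by
    simp; ring
  rw [h2]
  gcongr

lemma summable_heckeSum {a : ℕ → ℝ} {C β : ℝ} (ha : ∀ n : ℕ, |a n| ≤ C * (n : ℝ) ^ β)
    {z : ℂ} (hz : 0 < z.im) :
    Summable fun n : ℕ => (a (n + 1) : ℂ) *
      Complex.exp (2 * π * Complex.I * ((n : ℂ) + 1) * z) :=
  Summable.of_norm_bounded
    ((summable_rpow_mul_exp_neg β (by positivity : 0 < 2 * π * z.im)).mul_left C)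
    (fun n => norm_heckeSum_term_le ha n z)

lemma differentiableAt_heckeSum {a : ℕ → ℝ} {C β : ℝ} (hC : 0 ≤ C)
    (ha : ∀ n : ℕ, |a n| ≤ C * (n : ℝ) ^ β) {z : ℂ} (hz : 0 < z.im) :
    DifferentiableAt ℂ (heckeSum a) z := by
  have hopen : IsOpen {w : ℂ | z.im / 2 < w.im} := isOpen_lt continuous_const Complex.continuous_im
  have hsum := (summable_rpow_mul_exp_neg β (by positivity : 0 < 2 * π * (z.im / 2))).mul_left C
  have h := Complex.differentiableOn_tsum_of_summable_norm
    (F := fun (n : ℕ) (w : ℂ) => (a (n + 1) : ℂ) *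
      Complex.exp (2 * π * Complex.I * ((n : ℂ) + 1) * w)) hsum
    (fun n => by fun_prop) hopen (fun n w hw => (norm_heckeSum_term_le ha n w).trans ?_)
  · exact h.differentiableAt (hopen.mem_nhds (by simpa using hz))
  · have hw' : z.im / 2 < w.im := hw
    gcongr

section Mellin

variable {a : ℕ → ℝ} {C β M : ℝ}

/-- The values of `heckeSum` on the imaginary axis, scaled by the conductor. -/
noncomputable def heckeAxis (a : ℕ → ℝ) (M y : ℝ) : ℂ := heckeSum a (Complex.I * y / M)

lemma hasSum_heckeAxis (ha : ∀ n : ℕ, |a n| ≤ C * (n : ℝ) ^ β) (hM : 0 < M) {y : ℝ} (hy : 0 < y) :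
    HasSum (fun n : ℕ => (a (n + 1) : ℂ) * (exp (-(2 * π / M * (n + 1)) * y) : ℝ))
      (heckeAxis a M y) := by
  have him : 0 < (Complex.I * y / M).im := by
    rw [Complex.div_ofReal_im]; simpa using div_pos hy hM
  convert! (summable_heckeSum ha him).hasSum using 3 with n
  push_cast
  congr 1
  linear_combination (-(2 * π * (n + 1) * y / M : ℂ)) * Complex.I_mul_I

lemma summable_norm_div_rpow (ha : ∀ n : ℕ, |a n| ≤ C * (n : ℝ) ^ β) (hM : 0 < M)
    {c : ℝ} (hc : β + 1 < c) :
    Summable fun n : ℕ => ‖(a (n + 1) : ℂ)‖ / (2 * π / M * (n + 1)) ^ c := by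
  have h1 : Summable fun n : ℕ => C * ((2 * π / M) ^ c)⁻¹ * ((n : ℝ) + 1) ^ (β - c) := by
    refine Summable.mul_left _ ?_
    have := (summable_nat_add_iff 1).mpr (Real.summable_nat_rpow (p := β - c) |>.mpr (by linarith))
    simpa using this
  refine Summable.of_nonneg_of_le (fun n => by positivity) (fun n => ?_) h1
  have h2 := ha (n + 1)
  push_cast at h2
  rw [Complex.norm_real, norm_eq_abs, mul_rpow (by positivity) (by positivity),
    rpow_sub (by positivity)]
  calc |a (n + 1)| / ((2 * π / M) ^ c * ((n : ℝ) + 1) ^ c)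
      ≤ C * ((n : ℝ) + 1) ^ β / ((2 * π / M) ^ c * ((n : ℝ) + 1) ^ c) := by gcongr
    _ = _ := by field_simp

lemma hasSum_mellin_heckeAxis (hβ : 0 < β) (ha : ∀ n : ℕ, |a n| ≤ C * (n : ℝ) ^ β)
    (hM : 0 < M) {s : ℂ} (hs : β + 1 < s.re) :
    HasSum (fun n : ℕ => Complex.Gamma s * (a (n + 1) : ℂ) / ((2 * π / M * (n + 1) : ℝ) : ℂ) ^ s)
      (mellin (heckeAxis a M) s) :=
  hasSum_mellin (fun n => Or.inr (by positivity)) (by linarith)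
    (fun _ hy => hasSum_heckeAxis ha hM hy) (summable_norm_div_rpow ha hM hs)

lemma mellin_heckeAxis (hβ : 0 < β) (ha : ∀ n : ℕ, |a n| ≤ C * (n : ℝ) ^ β)
    (hM : 0 < M) {s : ℂ} (hs : β + 1 < s.re) :
    mellin (heckeAxis a M) s = ((2 * π / M : ℝ) : ℂ) ^ (-s) * Complex.Gamma s *
        ∑' n : ℕ, (a (n + 1) : ℂ) * ((n : ℂ) + 1) ^ (-s) := by
  rw [← (hasSum_mellin_heckeAxis hβ ha hM hs).tsum_eq, ← tsum_mul_left]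
  refine tsum_congr fun n => ?_
  have h1 : ((n : ℂ) + 1) = (((n : ℝ) + 1 : ℝ) : ℂ) := by push_cast; rfl
  rw [h1, Complex.ofReal_mul (2 * π / M),
    Complex.mul_cpow_ofReal_nonneg (by positivity) (by positivity),
    Complex.cpow_neg, Complex.cpow_neg]
  ring

lemma continuousAt_heckeAxis (hC : 0 ≤ C) (ha : ∀ n : ℕ, |a n| ≤ C * (n : ℝ) ^ β)
    (hM : 0 < M) {y : ℝ} (hy : 0 < y) : ContinuousAt (heckeAxis a M) y := by
  have him : 0 < (Complex.I * y / M).im := by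
    rw [Complex.div_ofReal_im]; simpa using div_pos hy hM
  exact ContinuousAt.comp (f := fun y : ℝ => Complex.I * y / M)
    (differentiableAt_heckeSum hC ha him).continuousAt (by fun_prop)

lemma norm_heckeAxis_le (hC : 0 ≤ C) (ha : ∀ n : ℕ, |a n| ≤ C * (n : ℝ) ^ β)
    (hM : 0 < M) {y : ℝ} (hy : 0 < y) :
    ‖heckeAxis a M y‖ ≤ ‖heckeAxis (fun n => C * (n : ℝ) ^ β) M y‖ := by
  have hb : ∀ n : ℕ, |C * (n : ℝ) ^ β| ≤ C * (n : ℝ) ^ β := fun n =>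
    (abs_of_nonneg (by positivity)).le
  have h1 := hasSum_heckeAxis hb hM hy
  have h2 : HasSum (fun n : ℕ => C * ((n + 1 : ℕ) : ℝ) ^ β * exp (-(2 * π / M * (n + 1)) * y))
      (∑' n : ℕ, C * ((n + 1 : ℕ) : ℝ) ^ β * exp (-(2 * π / M * (n + 1)) * y)) := by
    refine Summable.hasSum ?_
    have := h1.summable
    exact_mod_cast this
  have h3 : heckeAxis (fun n => C * (n : ℝ) ^ β) M y =
      ((∑' n : ℕ, C * ((n + 1 : ℕ) : ℝ) ^ β * exp (-(2 * π / M * (n + 1)) * y) : ℝ) : ℂ) := by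
    refine h1.unique ?_
    exact_mod_cast Complex.hasSum_ofReal.mpr h2
  rw [h3, Complex.norm_real, ← (hasSum_heckeAxis ha hM hy).tsum_eq]
  refine (tsum_of_norm_bounded h2 fun n => ?_).trans (le_abs_self _)
  rw [norm_mul, Complex.norm_real, Complex.norm_real, norm_eq_abs, norm_of_nonneg (exp_pos _).le]
  gcongr
  exact ha (n + 1)

lemma mellinConvergent_heckeAxis (hβ : 0 < β) (hC : 0 < C)
    (ha : ∀ n : ℕ, |a n| ≤ C * (n : ℝ) ^ β) (hM : 0 < M) {c : ℝ} (hc : β + 1 < c) :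
    MellinConvergent (heckeAxis a M) c := by
  set b : ℕ → ℝ := fun n => C * (n : ℝ) ^ β
  have hb : ∀ n : ℕ, |b n| ≤ C * (n : ℝ) ^ β := fun n =>
    (abs_of_nonneg (show (0 : ℝ) ≤ C * (n : ℝ) ^ β by positivity)).le
  have hmaj : MellinConvergent (heckeAxis b M) c := by
    by_contra hcon
    have h0 : mellin (heckeAxis b M) c = 0 := integral_undef hcon
    have h1 := hasSum_mellin_heckeAxis hβ hb hM (s := c) (by simpa using hc)
    rw [h0] at h1
    have h2 : HasSum (fun n : ℕ => Gamma c * b (n + 1) / (2 * π / M * (n + 1)) ^ c) 0 := by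
      rw [← Complex.hasSum_ofReal]
      convert h1 using 2 with n
      · rw [Complex.Gamma_ofReal]
        push_cast [Complex.ofReal_cpow (by positivity : 0 ≤ 2 * π / M * ((n : ℝ) + 1))]
        rfl
      · simp
    have hG : 0 < Gamma c := Gamma_pos_of_pos (by linarith)
    have h3 := (hasSum_zero_iff_of_nonneg (fun n => by
      have : 0 ≤ b (n + 1) := by positivity
      positivity)).mp h2
    have h4 := congrFun h3 0
    have hb1 : 0 < b (0 + 1) := by simp [b, hC]
    have : 0 < Gamma c * b (0 + 1) / (2 * π / M * ((0 : ℕ) + 1)) ^ c := by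
      rw [Nat.cast_zero]; positivity
    exact this.ne' h4
  refine Integrable.mono hmaj ?_ ?_
  · refine ContinuousOn.aestronglyMeasurable (fun y hy => ?_) measurableSet_Ioi
    refine ContinuousAt.continuousWithinAt (ContinuousAt.fun_smul ?_ ?_)
    · exact Complex.continuousAt_ofReal_cpow_const y _ (Or.inr (ne_of_gt hy))
    · exact continuousAt_heckeAxis hC.le ha hM hy
  · refine (ae_restrict_iff' measurableSet_Ioi).mpr (ae_of_all _ fun y hy => ?_)
    rw [norm_smul, norm_smul]
    gcongr
    exact norm_heckeAxis_le hC.le ha hM hy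

end Mellin

/-- Exponential decay at any rate below `π/2` on every closed vertical strip. -/
def StripDecay (Λ : ℂ → ℂ) : Prop :=
  ∀ σ₁ σ₂ κ : ℝ, κ < π / 2 →
    ∃ C, ∀ σ ∈ Icc σ₁ σ₂, ∀ t : ℝ, ‖Λ (σ + t * Complex.I)‖ ≤ C * exp (-κ * |t|)

lemma StripDecay.rapidDecay {Λ : ℂ → ℂ} (h : StripDecay Λ) (hc : Continuous Λ) (σ : ℝ) :
    RapidDecay fun t : ℝ => Λ (σ + t * Complex.I) := by
  refine ⟨hc.comp (by fun_prop), fun κ hκ => ?_⟩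
  obtain ⟨C, hC⟩ := h σ σ κ hκ
  exact ⟨C, fun t => hC σ (by simp) t⟩

section Inversion

variable {a : ℕ → ℝ} {C β M : ℝ} {Λ : ℂ → ℂ}

lemma expTransform_neg_I_mul_eq_heckeAxis (hβ : 0 < β) (hC : 0 < C)
    (ha : ∀ n : ℕ, |a n| ≤ C * (n : ℝ) ^ β) (hM : 0 < M) (hd : Differentiable ℂ Λ)
    (hΛ : ∀ s : ℂ, β + 1 < s.re → Λ s = mellin (heckeAxis a M) s) (hdec : StripDecay Λ)
    (σ₀ τ : ℝ) :
    expTransform (fun t : ℝ => Λ (σ₀ + t * Complex.I)) (-Complex.I * τ) =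
      2 * π * Complex.exp (τ * σ₀) * heckeAxis a M (exp τ) := by
  set c : ℝ := β + 2 with hc
  set h : ℂ → ℂ := fun s => Complex.exp (-τ * s) * Λ s with hh
  have hhd : Differentiable ℂ h := by
    intro s
    exact (by fun_prop : DifferentiableAt ℂ (fun s : ℂ => Complex.exp (-τ * s)) s).mul (hd s)
  obtain ⟨K, hK⟩ := hdec (min σ₀ c) (max σ₀ c) 1 (by linarith [pi_gt_three])
  have hKn : 0 ≤ K := by
    have := (norm_nonneg _).trans (hK σ₀ ⟨min_le_left _ _, le_max_left _ _⟩ 0)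
    simpa using this
  have hshift := integral_vertical_eq (σ₁ := σ₀) (σ₂ := c) (κ := 1)
    (C := exp (|τ| * (|σ₀| + |c|)) * K) hhd one_pos (fun σ hσ t => by
      have hσ' : |σ| ≤ |σ₀| + |c| := by
        refine (abs_le_max_abs_abs hσ.1 hσ.2).trans (max_le ?_ ?_)
        · rcases min_choice σ₀ c with h | h <;> rw [h]
          · linarith [abs_nonneg c]
          · linarith [abs_nonneg σ₀]
        · rcases max_choice σ₀ c with h | h <;> rw [h]
          · linarith [abs_nonneg c]
          · linarith [abs_nonneg σ₀]
      rw [hh, norm_mul, mul_assoc]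
      gcongr
      · rw [Complex.norm_exp, exp_le_exp]
        have : (-(τ : ℂ) * (σ + t * Complex.I)).re = -(τ * σ) := by simp
        rw [this]
        calc -(τ * σ) ≤ |τ * σ| := neg_le_abs _
          _ = |τ| * |σ| := abs_mul _ _
          _ ≤ _ := by gcongr
      · exact hK σ hσ t)
  have hline : ∀ t : ℝ, mellin (heckeAxis a M) (c + t * Complex.I) = Λ (c + t * Complex.I) :=
    fun t => (hΛ _ (by simp [hc])).symm
  have hvert : Complex.VerticalIntegrable (mellin (heckeAxis a M)) c := by
    unfold Complex.VerticalIntegrable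
    simp only [hline]
    have := (hdec.rapidDecay hd.continuous c).integrable_mul_cexp (φ := 0) (by simp [pi_pos])
    simpa using this
  have hinv := mellinInv_mellin_eq c (heckeAxis a M) (exp_pos τ)
    (mellinConvergent_heckeAxis hβ hC ha hM (by linarith)) hvert
    (continuousAt_heckeAxis hC.le ha hM (exp_pos τ))
  have hright : ∫ t : ℝ, h (c + t * Complex.I) = 2 * π * heckeAxis a M (exp τ) := by
    rw [← hinv, mellinInv]
    simp only [hline, smul_eq_mul, Complex.real_smul]
    have hcongr : ∀ t : ℝ, ((exp τ : ℝ) : ℂ) ^ (-((c : ℂ) + t * Complex.I)) *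
        Λ (c + t * Complex.I) = h (c + t * Complex.I) := by
      intro t
      rw [hh, Complex.cpow_def_of_ne_zero (by exact_mod_cast (exp_pos τ).ne'),
        ← Complex.ofReal_log (exp_pos τ).le, log_exp]
      simp only
      ring_nf
    simp only [hcongr]
    have : (2 * π : ℂ) ≠ 0 := by exact_mod_cast two_pi_pos.ne'
    push_cast
    rw [← mul_assoc, mul_one_div_cancel this, one_mul]
  have hleft : ∫ t : ℝ, h (σ₀ + t * Complex.I) = Complex.exp (-(τ * σ₀)) *
      expTransform (fun t : ℝ => Λ (σ₀ + t * Complex.I)) (-Complex.I * τ) := by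
    rw [expTransform, ← integral_const_mul]
    refine integral_congr_ae (ae_of_all _ fun t => ?_)
    simp only [hh]
    rw [mul_left_comm, ← Complex.exp_add, mul_comm]
    ring_nf
  rw [hleft, hright] at hshift
  have := congrArg (fun x => Complex.exp (τ * σ₀) * x) hshift
  simp only [← mul_assoc, ← Complex.exp_add] at this
  rw [add_neg_cancel, Complex.exp_zero, one_mul] at this
  rw [this]; ring

lemma expTransform_eq_heckeSum (hβ : 0 < β) (hC : 0 < C)
    (ha : ∀ n : ℕ, |a n| ≤ C * (n : ℝ) ^ β) (hM : 0 < M) (hd : Differentiable ℂ Λ)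
    (hΛ : ∀ s : ℂ, β + 1 < s.re → Λ s = mellin (heckeAxis a M) s) (hdec : StripDecay Λ)
    (σ₀ : ℝ) {φ : ℂ} (hφ : |φ.re| < π / 2) :
    expTransform (fun t : ℝ => Λ (σ₀ + t * Complex.I)) φ =
      2 * π * Complex.exp (Complex.I * φ * σ₀) *
        heckeSum a (Complex.I * Complex.exp (Complex.I * φ) / M) := by
  have hL : AnalyticOnNhd ℂ (expTransform fun t : ℝ => Λ (σ₀ + t * Complex.I))
      {φ : ℂ | |φ.re| < π / 2} :=
    (hdec.rapidDecay hd.continuous σ₀).differentiableOn_expTransform.analyticOnNhd isOpen_strip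
  have hR : AnalyticOnNhd ℂ (fun φ : ℂ => 2 * π * Complex.exp (Complex.I * φ * σ₀) *
        heckeSum a (Complex.I * Complex.exp (Complex.I * φ) / M)) {φ : ℂ | |φ.re| < π / 2} := by
    refine DifferentiableOn.analyticOnNhd (fun ψ hψ => ?_) isOpen_strip
    have him : 0 < (Complex.I * Complex.exp (Complex.I * ψ) / M).im := by
      have h1 : 0 < cos ψ.re := cos_pos_of_mem_Ioo (abs_lt.mp hψ)
      rw [Complex.div_ofReal_im, Complex.I_mul_im, Complex.exp_re]
      simp only [Complex.I_mul_im, Complex.I_mul_re]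
      positivity
    refine DifferentiableAt.differentiableWithinAt (DifferentiableAt.mul (by fun_prop) ?_)
    exact DifferentiableAt.comp (f := fun φ : ℂ => Complex.I * Complex.exp (Complex.I * φ) / M) ψ
      (differentiableAt_heckeSum hC.le ha him) (by fun_prop)
  have hconv : IsPreconnected {φ : ℂ | |φ.re| < π / 2} := by
    have : {φ : ℂ | |φ.re| < π / 2} = Complex.reLm ⁻¹' Ioo (-(π / 2)) (π / 2) := by
      ext ψ; simp [abs_lt]
    rw [this]
    exact ((convex_Ioo _ _).linear_preimage _).isPreconnected
  have hmap : Tendsto (fun τ : ℝ => -Complex.I * (τ : ℂ)) (𝓝[≠] 0) (𝓝[≠] 0) := by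
    refine tendsto_nhdsWithin_of_tendsto_nhds_of_eventually_within _ ?_ ?_
    · have : Continuous fun τ : ℝ => -Complex.I * (τ : ℂ) := by fun_prop
      simpa using (this.tendsto 0).mono_left nhdsWithin_le_nhds
    · filter_upwards [self_mem_nhdsWithin] with τ hτ
      simpa using hτ
  refine hL.eqOn_of_preconnected_of_frequently_eq hR hconv (z₀ := 0) (by simp [pi_pos]) ?_ hφ
  refine hmap.frequently (Eventually.frequently (Eventually.of_forall fun τ => ?_))
  have h1 : Complex.I * (-Complex.I * (τ : ℂ)) = τ := by
    linear_combination (-(τ : ℂ)) * Complex.I_mul_I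
  rw [expTransform_neg_I_mul_eq_heckeAxis hβ hC ha hM hd hΛ hdec, h1, heckeAxis,
    Complex.ofReal_exp]

end Inversion

/-- The Dirichlet series `∑_{n≥1} a(n) n^{-s}`. -/
noncomputable def heckeSeries (a : ℕ → ℝ) (s : ℂ) : ℂ :=
  ∑' n : ℕ, (a (n + 1) : ℂ) * ((n : ℂ) + 1) ^ (-s)

section DirichletSeries

variable {a a' : ℕ → ℝ} {C β : ℝ}

lemma lSeriesSummable_ofReal (ha : ∀ n : ℕ, |a n| ≤ C * (n : ℝ) ^ β) {s : ℂ} (hs : β + 1 < s.re) :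
    LSeriesSummable (fun n => (a n : ℂ)) s := by
  refine LSeriesSummable_of_le_const_mul_rpow hs ⟨C, fun n _ => ?_⟩
  simpa using ha n

lemma heckeSeries_eq_LSeries (ha : ∀ n : ℕ, |a n| ≤ C * (n : ℝ) ^ β) {s : ℂ}
    (hs : β + 1 < s.re) : heckeSeries a s = LSeries (fun n => (a n : ℂ)) s := by
  rw [LSeries, (lSeriesSummable_ofReal ha hs).tsum_eq_zero_add, LSeries.term_zero, zero_add]
  refine tsum_congr fun n => ?_
  rw [LSeries.term_of_ne_zero n.succ_ne_zero, Complex.cpow_neg]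
  push_cast
  rfl

lemma exists_heckeSeries_add_ne_zero (ha : ∀ n : ℕ, |a n| ≤ C * (n : ℝ) ^ β)
    (ha' : ∀ n : ℕ, |a' n| ≤ C * (n : ℝ) ^ β) (hnz : ∃ n : ℕ, a (n + 1) + a' (n + 1) ≠ 0) :
    ∃ x : ℝ, β + 1 < x ∧ heckeSeries a x + heckeSeries a' x ≠ 0 := by
  by_contra! hcon
  obtain ⟨n, hn⟩ := hnz
  have hev : (fun x : ℝ => LSeries ((fun n => (a n : ℂ)) + fun n => (a' n : ℂ)) x) =ᶠ[atTop] 0 := by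
    filter_upwards [eventually_gt_atTop (β + 1)] with x hx
    have hx' : β + 1 < (x : ℂ).re := by simpa using hx
    rw [LSeries_add (lSeriesSummable_ofReal ha hx') (lSeriesSummable_ofReal ha' hx'),
      ← heckeSeries_eq_LSeries ha hx', ← heckeSeries_eq_LSeries ha' hx']
    exact hcon x hx
  rcases LSeries_eventually_eq_zero_iff'.mp hev with h | h
  · have := h (n + 1) n.succ_ne_zero
    rw [Pi.add_apply] at this
    exact hn (by exact_mod_cast this)
  · have hle := LSeries.abscissaOfAbsConv_le_of_le_const_mul_rpow (x := β)
      (f := (fun n => (a n : ℂ)) + fun n => (a' n : ℂ)) ⟨C + C, fun n _ => by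
        refine (norm_add_le _ _).trans ?_
        rw [Complex.norm_real, Complex.norm_real, add_mul]
        exact add_le_add (ha n) (ha' n)⟩
    rw [h, top_le_iff] at hle
    exact EReal.coe_ne_top (β + 1) (by exact_mod_cast hle)

lemma heckeSeries_conj (a : ℕ → ℝ) (s : ℂ) :
    heckeSeries a (starRingEnd ℂ s) = starRingEnd ℂ (heckeSeries a s) := by
  rw [heckeSeries, heckeSeries, Complex.conj_tsum]
  refine tsum_congr fun n => ?_
  have h1 : ((n : ℂ) + 1) = (((n : ℝ) + 1 : ℝ) : ℂ) := by push_cast; rfl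
  rw [map_mul, Complex.conj_ofReal, h1, ← map_neg, Complex.cpow_conj, Complex.conj_ofReal]
  rw [Complex.arg_ofReal_of_nonneg (by positivity)]
  exact pi_ne_zero.symm

/-- The completed Dirichlet series of real coefficients is real on the real axis. -/
lemma conj_eq_of_eq_heckeSeries {Λ : ℂ → ℂ} (hd : Differentiable ℂ Λ) {x : ℝ} (hx : 0 ≤ x)
    (hΛ : ∀ s : ℂ, β + 1 < s.re → Λ s = (x : ℂ) ^ (-s) * Complex.Gamma s * heckeSeries a s)
    (s : ℂ) : Λ (starRingEnd ℂ s) = starRingEnd ℂ (Λ s) := by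
  set Λc : ℂ → ℂ := fun z => starRingEnd ℂ (Λ (starRingEnd ℂ z)) with hΛc
  have hdc : Differentiable ℂ Λc := fun z => by
    have := (hd (starRingEnd ℂ z)).conj_conj
    rwa [Complex.conj_conj] at this
  have heq : Λ = Λc := by
    refine AnalyticOnNhd.eq_of_eventuallyEq (z₀ := ((β + 2 : ℝ) : ℂ))
      (hd.differentiableOn.analyticOnNhd isOpen_univ)
      (hdc.differentiableOn.analyticOnNhd isOpen_univ) ?_
    have hopen : IsOpen {w : ℂ | β + 1 < w.re} := isOpen_lt continuous_const Complex.continuous_re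
    filter_upwards [hopen.mem_nhds (show β + 1 < ((β + 2 : ℝ) : ℂ).re by simp)] with w hw
    have hw' : β + 1 < (starRingEnd ℂ w).re := by simpa using hw
    rw [hΛc]
    simp only
    rw [hΛ w hw, hΛ _ hw', map_mul, map_mul, heckeSeries_conj, Complex.conj_conj, Complex.Gamma_conj,
      Complex.conj_conj, ← map_neg, Complex.cpow_conj, Complex.conj_conj, Complex.conj_ofReal]
    rw [Complex.arg_ofReal_of_nonneg hx]
    exact pi_ne_zero.symm
  have := congrFun heq (starRingEnd ℂ s)
  simpa only [hΛc, Complex.conj_conj] using this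

end DirichletSeries

lemma exists_forall_Ioo_ne_zero {h : ℂ → ℂ} (hd : Differentiable ℂ h) (hne : ∃ z, h z ≠ 0) :
    ∃ δ > 0, ∀ t ∈ Ioo (0 : ℝ) δ, h t ≠ 0 := by
  have han : AnalyticOnNhd ℂ h univ := hd.differentiableOn.analyticOnNhd isOpen_univ
  rcases (han 0 (mem_univ _)).eventually_eq_zero_or_eventually_ne_zero with h0 | h0
  · obtain ⟨z, hz⟩ := hne
    have h1 : AnalyticOnNhd ℂ (fun _ : ℂ => (0 : ℂ)) univ := fun _ _ => analyticAt_const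
    exact absurd (congrFun (han.eq_of_eventuallyEq h1 h0) z) hz
  · obtain ⟨δ, hδ, hsub⟩ := Metric.mem_nhdsWithin_iff.mp h0
    refine ⟨δ, hδ, fun t ht => hsub ⟨?_, ?_⟩⟩
    · simpa [abs_of_pos ht.1] using ht.2
    · simpa using ht.1.ne'

lemma forall_pos_or_forall_neg {r : ℝ → ℝ} (hr : Continuous r) {δ : ℝ}
    (hne : ∀ t ∈ Ioo 0 δ, r t ≠ 0) :
    (∀ t ∈ Ioo 0 δ, 0 < r t) ∨ ∀ t ∈ Ioo 0 δ, 0 < -r t := by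
  by_contra! hcon
  obtain ⟨⟨s, hs, hs0⟩, t, ht, ht0⟩ := hcon
  obtain ⟨c, hc, hc0⟩ := isPreconnected_Ioo.intermediate_value hs ht hr.continuousOn
    (show (0 : ℝ) ∈ Icc (r s) (r t) from ⟨hs0, by linarith⟩)
  exact hne c hc hc0

lemma RapidDecay.neg {r : ℝ → ℝ} (hr : RapidDecay r) : RapidDecay fun t => -r t :=
  ⟨hr.1.neg, fun κ hκ => by simpa only [norm_neg] using hr.2 κ hκ⟩

lemma RapidDecay.re {g : ℝ → ℂ} (hg : RapidDecay g) : RapidDecay fun t => (g t).re :=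
  ⟨Complex.continuous_re.comp hg.1, fun κ hκ => (hg.2 κ hκ).imp fun _ h t =>
    (Complex.abs_re_le_norm _).trans (h t)⟩

lemma exists_hasSignChanges_of_moments_of_ne_zero {r : ℝ → ℝ} (hr : RapidDecay r)
    (heven : ∀ t, r (-t) = r t) {δ : ℝ} (hδ : 0 < δ) (hne : ∀ t ∈ Ioo 0 δ, r t ≠ 0)
    {K α A d : ℝ} (hA : 0 < A) (hd : 0 < d) (hdA : 8 * π ^ 2 * d ^ 2 ≤ A)
    (hmom : ∀ u, 0 < u → u < π / 2 → ∀ n : ℕ, |∫ t, r t * t ^ n * exp ((π / 2 - u) * t)| ≤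
      K * u ^ (-α) * exp (-A / u) * (n.factorial * (2 / u) ^ n)) (T₀ : ℝ) :
    ∃ T, T₀ ≤ T ∧ ∃ m : ℕ, d * √T ≤ m ∧ HasSignChanges r m T := by
  rcases forall_pos_or_forall_neg hr.1 hne with h | h
  · exact exists_hasSignChanges_of_moments hr heven hδ h hA hd hdA hmom T₀
  · obtain ⟨T, hT, m, hm, t, ht, htI, hts⟩ := exists_hasSignChanges_of_moments hr.neg
      (fun t => by rw [heven]) hδ h hA hd hdA (fun u hu hu2 n => by
        simpa only [neg_mul, integral_neg, abs_neg] using hmom u hu hu2 n) T₀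
    exact ⟨T, hT, m, hm, t, ht, htI, fun i => by simpa using hts i⟩

lemma expTransform_half_add_comp_neg {g : ℝ → ℂ} (hg : RapidDecay g) {φ : ℂ}
    (hφ : |φ.re| < π / 2) :
    expTransform (fun t => (g t + g (-t)) / 2) φ =
      (expTransform g φ + expTransform g (-φ)) / 2 := by
  have h1 : expTransform g (-φ) = ∫ t : ℝ, g (-t) * Complex.exp (φ * t) := by
    rw [expTransform, ← integral_neg_eq_self]
    simp
  have h2 : Integrable fun t : ℝ => g (-t) * Complex.exp (φ * t) := by
    have := (hg.integrable_mul_cexp (φ := -φ) (by simpa using hφ)).comp_neg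
    simpa using this
  rw [h1, expTransform, expTransform, ← integral_add (hg.integrable_mul_cexp hφ) h2,
    ← integral_div]
  refine integral_congr_ae (ae_of_all _ fun t => ?_)
  simp only
  ring

lemma I_mul_exp_I_mul_pi_div_two_sub (w : ℂ) :
    Complex.I * Complex.exp (Complex.I * (π / 2 - w)) = -Complex.exp (-Complex.I * w) := by
  have h : Complex.I * (π / 2 - w) = π / 2 * Complex.I + -Complex.I * w := by ring
  rw [h, Complex.exp_add, Complex.exp_pi_div_two_mul_I, ← mul_assoc, Complex.I_mul_I, neg_one_mul]

lemma I_mul_exp_I_mul_neg_pi_div_two_sub (w : ℂ) :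
    Complex.I * Complex.exp (Complex.I * -(π / 2 - w)) = Complex.exp (Complex.I * w) := by
  have h : Complex.I * -(π / 2 - w) = -π / 2 * Complex.I + Complex.I * w := by ring
  rw [h, Complex.exp_add, Complex.exp_neg_pi_div_two_mul_I, ← mul_assoc, mul_neg, Complex.I_mul_I,
    neg_neg, one_mul]

/-- Decay of the symmetrised exponential transform near the edge of its strip. -/
lemma norm_expTransform_half_add_comp_neg_le {a : ℕ → ℝ} {C β M : ℝ} {Λ : ℂ → ℂ} (hβ : 0 < β)
    (hC : 0 < C) (ha : ∀ n : ℕ, |a n| ≤ C * (n : ℝ) ^ β) (hM : 0 < M) (hd : Differentiable ℂ Λ)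
    (hΛ : ∀ s : ℂ, β + 1 < s.re → Λ s = mellin (heckeAxis a M) s) (hdec : StripDecay Λ)
    {σ₀ : ℝ} (hσ₀ : 0 ≤ σ₀) {u F G : ℝ} (hu : u < π / 2) {w : ℂ} (hw : ‖w - u‖ ≤ u / 2)
    (hu0 : 0 < u)
    (hF : ‖heckeSum a (-Complex.exp (-Complex.I * w) / M)‖ ≤ F)
    (hG : ‖heckeSum a (Complex.exp (Complex.I * w) / M)‖ ≤ G) :
    ‖expTransform (fun t : ℝ => (Λ (σ₀ + t * Complex.I) + Λ (σ₀ + (-t : ℝ) * Complex.I)) / 2)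
      (π / 2 - w)‖ ≤ π * exp (π * σ₀) * (F + G) := by
  have hre : |w.re - u| ≤ u / 2 := by
    have := (Complex.abs_re_le_norm _).trans hw
    simpa using this
  have him : |w.im| ≤ u / 2 := by
    have := (Complex.abs_im_le_norm _).trans hw
    simpa using this
  obtain ⟨hre1, hre2⟩ := abs_le.mp hre
  obtain ⟨him1, him2⟩ := abs_le.mp him
  set φ : ℂ := π / 2 - w with hφdef
  have hφr : φ.re = π / 2 - w.re := by
    rw [hφdef, Complex.sub_re]; congr 1; exact_mod_cast Complex.ofReal_re (π / 2)
  have hφi : φ.im = -w.im := by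
    have : ((π : ℂ) / 2).im = 0 := by exact_mod_cast Complex.ofReal_im (π / 2)
    rw [hφdef, Complex.sub_im, this, zero_sub]
  have hφ : |φ.re| < π / 2 := by
    rw [hφr, abs_lt]; constructor <;> linarith
  have hexp : ∀ ψ : ℂ, |ψ.im| ≤ π → ‖Complex.exp (Complex.I * ψ * σ₀)‖ ≤ exp (π * σ₀) := by
    intro ψ hψ
    rw [Complex.norm_exp, Complex.re_mul_ofReal, Complex.I_mul_re]
    gcongr
    exact (neg_le_abs _).trans hψ
  have hφi' : |φ.im| ≤ π := by
    rw [hφi, abs_neg]; linarith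
  have hL : ∀ ψ : ℂ, |ψ.re| < π / 2 → |ψ.im| ≤ π → ∀ H : ℝ,
      ‖heckeSum a (Complex.I * Complex.exp (Complex.I * ψ) / M)‖ ≤ H →
      ‖expTransform (fun t : ℝ => Λ (σ₀ + t * Complex.I)) ψ‖ ≤ 2 * π * exp (π * σ₀) * H := by
    intro ψ hψ hψ' H hH
    rw [expTransform_eq_heckeSum hβ hC ha hM hd hΛ hdec σ₀ hψ, norm_mul, norm_mul]
    have h2 : ‖(2 * π : ℂ)‖ = 2 * π := by
      rw [norm_mul, Complex.norm_real, Complex.norm_ofNat, norm_of_nonneg pi_pos.le]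
    rw [h2]
    gcongr
    exact hexp ψ hψ'
  have h1 := hL φ hφ hφi' F (by rwa [hφdef, I_mul_exp_I_mul_pi_div_two_sub])
  have h2 := hL (-φ) (by simpa using hφ) (by simpa using hφi') G
    (by rwa [hφdef, I_mul_exp_I_mul_neg_pi_div_two_sub])
  have h3 := expTransform_half_add_comp_neg (hdec.rapidDecay hd.continuous σ₀) hφ
  rw [h3, norm_div, Complex.norm_ofNat, div_le_iff₀ two_pos]
  refine (norm_add_le _ _).trans ?_
  linarith

/-- In the Hecke-pair setup, with nonvanishing `a + a'` and exponential decay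
bounds for `f` near the rotated rays, there is `d > 0` such that for arbitrarily large `T`
the real-valued function `t ↦ R(t)` has at least `d √T` sign changes in `[0, T]`. -/
theorem stmt_9 (k N : ℕ) (hk : 0 < k) (hN : 0 < N)
    (σ₀ : ℝ) (hσ₀ : σ₀ = (k : ℝ) / 2 + 1 / 4)
    (a a' : ℕ → ℝ) (C β : ℝ) (hC : 0 < C) (hβ : 0 < β)
    (ha : ∀ n : ℕ, |a n| ≤ C * (n : ℝ) ^ β)
    (ha' : ∀ n : ℕ, |a' n| ≤ C * (n : ℝ) ^ β)
    (Λ Λ' : ℂ → ℂ)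
    (hΛdiff : Differentiable ℂ Λ) (hΛ'diff : Differentiable ℂ Λ')
    (hΛ : ∀ s : ℂ, β + 1 < s.re →
      Λ s = ((2 * Real.pi / Real.sqrt (4 * (N : ℝ)) : ℝ) : ℂ) ^ (-s) * Complex.Gamma s *
        ∑' n : ℕ, (a (n + 1) : ℂ) * ((n : ℂ) + 1) ^ (-s))
    (hΛ' : ∀ s : ℂ, β + 1 < s.re →
      Λ' s = ((2 * Real.pi / Real.sqrt (4 * (N : ℝ)) : ℝ) : ℂ) ^ (-s) * Complex.Gamma s *
        ∑' n : ℕ, (a' (n + 1) : ℂ) * ((n : ℂ) + 1) ^ (-s))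
    (hFE : ∀ s : ℂ, Λ s = Λ' ((k : ℂ) + 1 / 2 - s))
    (hstrip : ∀ σ₁ σ₂ : ℝ, ∃ C' B' : ℝ, ∀ σ t : ℝ, σ₁ ≤ σ → σ ≤ σ₂ →
      norm (Λ ((σ : ℂ) + (t : ℂ) * Complex.I)) +
        norm (Λ' ((σ : ℂ) + (t : ℂ) * Complex.I)) ≤
          C' * (1 + |t|) ^ B' * Real.exp (-Real.pi * |t| / 2))
    (R : ℝ → ℂ)
    (hR : ∀ t : ℝ, R t =
      (Λ ((σ₀ : ℂ) + (t : ℂ) * Complex.I) + Λ' ((σ₀ : ℂ) + (t : ℂ) * Complex.I)) / 2)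
    (hnz : ∃ n : ℕ, a (n + 1) + a' (n + 1) ≠ 0)
    (A B Cf Df : ℝ) (hA : 0 < A) (hB : 0 < B) (hCf : 0 < Cf) (hDf : 0 < Df)
    (hfb : ∀ u₀ : ℝ, 0 < u₀ → u₀ < Real.pi / 2 →
      ∀ w : ℂ, norm (w - (u₀ : ℂ)) ≤ u₀ / 2 →
        norm
            (heckeSum a (-Complex.exp (-Complex.I * w) / (Real.sqrt (4 * (N : ℝ)) : ℂ))) ≤
          Cf * u₀ ^ (-((k : ℝ) + 1 / 2)) * Real.exp (-A / u₀))
    (hfb' : ∀ u₀ : ℝ, 0 < u₀ → u₀ < Real.pi / 2 →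
      ∀ w : ℂ, norm (w - (u₀ : ℂ)) ≤ u₀ / 2 →
        norm
            (heckeSum a (Complex.exp (Complex.I * w) / (Real.sqrt (4 * (N : ℝ)) : ℂ))) ≤
          Df * u₀ ^ (-((k : ℝ) + 1 / 2)) * Real.exp (-B / u₀)) :
    ∃ d > (0 : ℝ), ∀ T₀ : ℝ, ∃ T : ℝ, T₀ ≤ T ∧
      ∃ m : ℕ, d * Real.sqrt T ≤ (m : ℝ) ∧
        ∃ t : Fin (m + 1) → ℝ, StrictMono t ∧ (∀ i, t i ∈ Set.Icc (0 : ℝ) T) ∧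
          ∀ i : Fin m, (R (t i.castSucc)).re * (R (t i.succ)).re < 0 := by
  have hM : 0 < √(4 * (N : ℝ)) := by positivity
  have hσ₀' : 0 ≤ σ₀ := by rw [hσ₀]; positivity
  have hmellin : ∀ s : ℂ, β + 1 < s.re → Λ s = mellin (heckeAxis a √(4 * (N : ℝ))) s :=
    fun s hs => (hΛ s hs).trans (mellin_heckeAxis hβ ha hM hs).symm
  have hdec : StripDecay Λ := fun σ₁ σ₂ κ hκ => by
    obtain ⟨C', B', h⟩ := hstrip σ₁ σ₂
    exact exists_strip_exp_bound
      (fun σ t h1 h2 => (le_add_of_nonneg_right (norm_nonneg _)).trans (h σ t h1 h2)) hκ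
  have hdual : ∀ t : ℝ, Λ' (σ₀ + t * Complex.I) = Λ (σ₀ + (-t : ℝ) * Complex.I) := by
    intro t
    rw [hFE, hσ₀]
    push_cast
    ring_nf
  have hRL : ∀ t, R t = (Λ (σ₀ + t * Complex.I) + Λ (σ₀ + (-t : ℝ) * Complex.I)) / 2 :=
    fun t => by rw [hR, hdual]
  have hRre : ∀ t, R t = ((R t).re : ℂ) := by
    intro t
    have h1 := conj_eq_of_eq_heckeSeries hΛdiff (by positivity) hΛ (σ₀ + t * Complex.I)
    have h2 : starRingEnd ℂ ((σ₀ : ℂ) + t * Complex.I) = σ₀ + (-t : ℝ) * Complex.I := by simp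
    rw [h2] at h1
    have h3 : R t = ((Λ (σ₀ + t * Complex.I)).re : ℂ) := by
      rw [hRL, h1, Complex.add_conj]; push_cast; ring
    rw [h3, Complex.ofReal_re]
  have hRdecay : RapidDecay R := by
    have h1 := hdec.rapidDecay hΛdiff.continuous σ₀
    refine ⟨?_, fun κ hκ => ?_⟩
    · rw [funext hRL]
      exact (h1.1.add (h1.1.comp continuous_neg)).div_const 2
    · obtain ⟨K, hK⟩ := h1.2 κ hκ
      refine ⟨K, fun t => ?_⟩
      have h2 := hK t
      have h3 := hK (-t)
      rw [abs_neg] at h3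
      rw [hRL, norm_div, Complex.norm_ofNat, div_le_iff₀ two_pos]
      exact (norm_add_le _ _).trans (by linarith)
  have heven : ∀ t, (R (-t)).re = (R t).re := fun t => by
    rw [hRL, hRL, neg_neg, add_comm]
  obtain ⟨δ, hδ, hne⟩ : ∃ δ > 0, ∀ t ∈ Ioo (0 : ℝ) δ, (R t).re ≠ 0 := by
    obtain ⟨x, hx, hxne⟩ := exists_heckeSeries_add_ne_zero ha ha' hnz
    have hxre : β + 1 < (x : ℂ).re := by simpa using hx
    have hdiff : Differentiable ℂ fun z : ℂ => Λ (σ₀ + z * Complex.I) + Λ' (σ₀ + z * Complex.I) :=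
      (hΛdiff.comp (by fun_prop)).add (hΛ'diff.comp (by fun_prop))
    obtain ⟨δ, hδ, h⟩ := exists_forall_Ioo_ne_zero hdiff
      ⟨(σ₀ - x) * Complex.I, by
        have h1 : (σ₀ : ℂ) + (σ₀ - x) * Complex.I * Complex.I = x := by
          linear_combination (σ₀ - x : ℂ) * Complex.I_mul_I
        rw [h1, hΛ _ hxre, hΛ' _ hxre, ← mul_add]
        refine mul_ne_zero (mul_ne_zero ?_ (Complex.Gamma_ne_zero_of_re_pos (by linarith))) hxne
        rw [Complex.cpow_ne_zero_iff]
        left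
        have : 0 < 2 * π / √(4 * (N : ℝ)) := by positivity
        exact_mod_cast this.ne'⟩
    refine ⟨δ, hδ, fun t ht h0 => h t ht ?_⟩
    have h2 := hRre t
    rw [h0, Complex.ofReal_zero, hR] at h2
    simpa using h2
  set A₀ := min A B with hA₀
  have hA₀pos : 0 < A₀ := lt_min hA hB
  have hmom : ∀ u, 0 < u → u < π / 2 → ∀ n : ℕ,
      |∫ t, (R t).re * t ^ n * exp ((π / 2 - u) * t)| ≤
        π * exp (π * σ₀) * (Cf + Df) * u ^ (-((k : ℝ) + 1 / 2)) * exp (-A₀ / u) *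
          (n.factorial * (2 / u) ^ n) := by
    intro u hu hu2 n
    refine hRdecay.abs_integral_re_mul_pow_le hu hu2 (fun w hw => ?_) n
    rw [funext hRL]
    refine (norm_expTransform_half_add_comp_neg_le hβ hC ha hM hΛdiff hmellin hdec hσ₀' hu2 hw hu
      (hfb u hu hu2 w hw) (hfb' u hu hu2 w hw)).trans ?_
    have hle : ∀ X : ℝ, A₀ ≤ X → exp (-X / u) ≤ exp (-A₀ / u) := fun X hX => by gcongr
    calc π * exp (π * σ₀) * (Cf * u ^ (-((k : ℝ) + 1 / 2)) * exp (-A / u) +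
          Df * u ^ (-((k : ℝ) + 1 / 2)) * exp (-B / u))
        ≤ π * exp (π * σ₀) * (Cf * u ^ (-((k : ℝ) + 1 / 2)) * exp (-A₀ / u) +
          Df * u ^ (-((k : ℝ) + 1 / 2)) * exp (-A₀ / u)) := by
          gcongr π * exp (π * σ₀) * (_ * ?_ + _ * ?_)
          · exact hle A (min_le_left _ _)
          · exact hle B (min_le_right _ _)
      _ = _ := by ring
  refine ⟨√(A₀ / 8) / π, by positivity, fun T₀ => ?_⟩
  refine exists_hasSignChanges_of_moments_of_ne_zero hRdecay.re heven hδ hne hA₀pos (by positivity)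
    ?_ hmom T₀
  rw [div_pow, sq_sqrt (by positivity)]
  exact le_of_eq (by field_simp)
end

section
/- Let a : ℕ → ℂ satisfy |a(n)| ≤ C n^α for some C, α > 0, let κ > 0, and suppose the function f(z) = ∑_{n≥1} a(n) e^{2πinz} (Im z > 0) satisfies |f(x + iy)| ≤ 𝒜 y^{−κ} for all x ∈ ℝ, y > 0 and some constant 𝒜. Then there exists a constant C′ > 0 such that for every integer M ≥ 2 and every z = x + iy with y > 0, |∑_{m=1}^{M} a(m) e^{2πimz} − δ · f(z)| ≤ C′ · e^{−2πy(M+1)} · M^{κ} · log M, where δ = 0 if 0 < y ≤ 1/(2πM) and δ = 1 if y > 1/(2πM). -/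
/-- The sum `f(z) = ∑_{n≥1} a(n) e^{2πinz}` attached to coefficients `a : ℕ → ℂ`. -/
noncomputable def cuspSum (a : ℕ → ℂ) (z : ℂ) : ℂ :=
  ∑' n : ℕ, a (n + 1) * Complex.exp (2 * Real.pi * Complex.I * ((n : ℂ) + 1) * z)

/-- The function `z ↦ e^{2πiz}`. -/
noncomputable def nome (z : ℂ) : ℂ := Complex.exp (2 * Real.pi * Complex.I * z)

lemma nome_add (z w : ℂ) : nome (z + w) = nome z * nome w := by
  simp only [nome, mul_add, Complex.exp_add]

lemma nome_pow (z : ℂ) (m : ℕ) :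
    nome z ^ m = Complex.exp (2 * Real.pi * Complex.I * (m : ℂ) * z) := by
  rw [nome, ← Complex.exp_nat_mul]
  congr 1
  ring

lemma norm_nome (z : ℂ) : ‖nome z‖ = Real.exp (-2 * Real.pi * z.im) := by
  simp [nome, Complex.norm_exp]

lemma continuous_nome : Continuous nome := by
  unfold nome
  fun_prop

lemma cuspSum_eq_tsum (a : ℕ → ℂ) (z : ℂ) :
    cuspSum a z = ∑' n : ℕ, a (n + 1) * nome z ^ (n + 1) := by
  simp only [cuspSum, nome_pow]
  push_cast
  rfl

lemma summable_norm_mul_pow {a : ℕ → ℂ} {C α : ℝ}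
    (ha : ∀ n : ℕ, 1 ≤ n → ‖a n‖ ≤ C * (n : ℝ) ^ α) {r : ℝ} (hr0 : 0 ≤ r) (hr : r < 1) :
    Summable fun n : ℕ => ‖a (n + 1)‖ * r ^ (n + 1) := by
  have hC : 0 ≤ C := by simpa using (norm_nonneg _).trans (ha 1 le_rfl)
  obtain ⟨k, hk⟩ := exists_nat_ge α
  have h := (summable_nat_add_iff 1).2
    ((summable_pow_mul_geometric_of_norm_lt_one k
      (show ‖r‖ < 1 by rwa [Real.norm_of_nonneg hr0])).mul_left C)
  refine h.of_nonneg_of_le (fun n => by positivity) fun n => ?_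
  rw [← mul_assoc]
  gcongr
  refine (ha _ n.succ_pos).trans ?_
  gcongr
  rw [← Real.rpow_natCast]
  exact Real.rpow_le_rpow_of_exponent_le (by simp) hk

lemma integral_nome_int_mul (k : ℤ) :
    ∫ v in (-(1 / 2) : ℝ)..(1 / 2), Complex.exp (2 * Real.pi * Complex.I * k * v) =
      if k = 0 then 1 else 0 := by
  split_ifs with h
  · simp [h]; norm_num
  · have hc : 2 * (Real.pi : ℂ) * Complex.I * k ≠ 0 := by
      simp [h, Real.pi_ne_zero]
    rw [integral_exp_mul_complex hc, div_eq_zero_iff]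
    left
    rw [sub_eq_zero, Complex.exp_eq_exp_iff_exists_int]
    exact ⟨k, by push_cast; ring⟩

lemma norm_nome_add_ofReal (s : ℂ) (v : ℝ) : ‖nome (s + v)‖ = ‖nome s‖ := by
  simp [norm_nome]

lemma norm_nome_sub_ofReal (s : ℂ) (v : ℝ) : ‖nome (s - v)‖ = ‖nome s‖ := by
  simp [norm_nome]

lemma norm_nome_lt_one {s : ℂ} (hs : 0 < s.im) : ‖nome s‖ < 1 := by
  rw [norm_nome, Real.exp_lt_one_iff]
  have := Real.pi_pos
  nlinarith [mul_pos this hs]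

lemma continuous_cuspSum_add_ofReal {a : ℕ → ℂ} {C α : ℝ}
    (ha : ∀ n : ℕ, 1 ≤ n → ‖a n‖ ≤ C * (n : ℝ) ^ α) {s : ℂ} (hs : 0 < s.im) :
    Continuous fun v : ℝ => cuspSum a (s + v) := by
  simp only [cuspSum_eq_tsum]
  refine continuous_tsum (fun n => ?_)
    (summable_norm_mul_pow ha (norm_nonneg _) (norm_nome_lt_one hs)) fun n v => ?_
  · exact continuous_const.mul ((continuous_nome.comp (by fun_prop)).pow _)
  · rw [norm_mul, norm_pow, norm_nome_add_ofReal]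

/-- Extraction of a coefficient by integrating over a horizontal segment of length one. -/
lemma integral_cuspSum_mul_nome_pow {a : ℕ → ℂ} {C α : ℝ}
    (ha : ∀ n : ℕ, 1 ≤ n → ‖a n‖ ≤ C * (n : ℝ) ^ α) {s : ℂ} (hs : 0 < s.im) (w : ℂ)
    {m : ℕ} (hm : 1 ≤ m) :
    ∫ v in (-(1 / 2) : ℝ)..(1 / 2), cuspSum a (s + v) * nome (w - v) ^ m =
      a m * nome (s + w) ^ m := by
  have hsum := (summable_norm_mul_pow ha (norm_nonneg _) (norm_nome_lt_one hs)).mul_right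
    (‖nome w‖ ^ m)
  have hnorm (n : ℕ) (v : ℝ) : ‖a (n + 1) * nome (s + v) ^ (n + 1) * nome (w - v) ^ m‖ =
      ‖a (n + 1)‖ * ‖nome s‖ ^ (n + 1) * ‖nome w‖ ^ m := by
    rw [norm_mul, norm_mul, norm_pow, norm_pow, norm_nome_add_ofReal, norm_nome_sub_ofReal]
  have hcont (n : ℕ) :
      Continuous fun v : ℝ => a (n + 1) * nome (s + v) ^ (n + 1) * nome (w - v) ^ m :=
    (continuous_const.mul ((continuous_nome.comp (by fun_prop)).pow _)).mul
      ((continuous_nome.comp (by fun_prop)).pow _)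
  have hsummable (v : ℝ) : Summable fun n : ℕ => a (n + 1) * nome (s + v) ^ (n + 1) :=
    .of_norm <| by
      simpa [norm_nome_add_ofReal] using
        summable_norm_mul_pow ha (norm_nonneg _) (norm_nome_lt_one hs)
  have key := intervalIntegral.hasSum_integral_of_dominated_convergence
    (a := (-(1 / 2) : ℝ)) (b := 1 / 2) (μ := MeasureTheory.volume)
    (F := fun (n : ℕ) (v : ℝ) => a (n + 1) * nome (s + v) ^ (n + 1) * nome (w - v) ^ m)
    (f := fun v : ℝ => cuspSum a (s + v) * nome (w - v) ^ m)
    (fun n _ => ‖a (n + 1)‖ * ‖nome s‖ ^ (n + 1) * ‖nome w‖ ^ m)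
    (fun n => (hcont n).aestronglyMeasurable)
    (fun n => .of_forall fun v _ => (hnorm n v).le)
    (.of_forall fun v _ => hsum) intervalIntegrable_const
    (.of_forall fun v _ => by
      rw [cuspSum_eq_tsum]
      exact (hsummable v).hasSum.mul_right _)
  have hterm (n : ℕ) : ∫ v in (-(1 / 2) : ℝ)..(1 / 2),
      a (n + 1) * nome (s + v) ^ (n + 1) * nome (w - v) ^ m =
        if n = m - 1 then a m * nome (s + w) ^ m else 0 := by
    have (v : ℝ) : a (n + 1) * nome (s + v) ^ (n + 1) * nome (w - v) ^ m =
        a (n + 1) * nome s ^ (n + 1) * nome w ^ m *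
          Complex.exp (2 * Real.pi * Complex.I * ((n + 1 - m : ℤ) : ℂ) * v) := by
      simp only [nome_pow, mul_assoc, ← Complex.exp_add]
      congr 2
      push_cast
      ring
    simp only [this]
    rw [intervalIntegral.integral_const_mul, integral_nome_int_mul]
    by_cases h : n = m - 1
    · obtain rfl : m = n + 1 := by omega
      simp [nome_add, mul_pow, mul_assoc]
    · rw [if_neg h, if_neg (by omega), mul_zero]
  simp only [hterm] at key
  exact key.unique (hasSum_ite_eq _ _)

lemma integral_one_div_add_abs {δ : ℝ} (hδ : 0 < δ) :
    ∫ v in (-(1 / 2) : ℝ)..(1 / 2), 1 / (δ + 4 * |v|) = 1 / 2 * Real.log (1 + 2 / δ) := by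
  have hcont : Continuous fun v : ℝ => 1 / (δ + 4 * |v|) :=
    continuous_const.div (by fun_prop) fun v => by positivity
  have hpos : ∫ v in (0 : ℝ)..(1 / 2), 1 / (δ + 4 * |v|) = 1 / 4 * Real.log (1 + 2 / δ) := by
    have h : ∀ v ∈ Set.uIcc (0 : ℝ) (1 / 2),
        HasDerivAt (fun v : ℝ => 1 / 4 * Real.log (δ + 4 * v)) (1 / (δ + 4 * |v|)) v := by
      intro v hv
      rw [Set.uIcc_of_le (by norm_num)] at hv
      have hv0 : 0 ≤ v := hv.1
      have hne : δ + 4 * v ≠ 0 := by positivity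
      have h1 : HasDerivAt (fun v : ℝ => δ + 4 * v) 4 v := by
        simpa using ((hasDerivAt_id v).const_mul 4).const_add δ
      refine ((h1.log hne).const_mul (1 / 4)).congr_deriv ?_
      rw [abs_of_nonneg hv0]
      field_simp
    rw [intervalIntegral.integral_eq_sub_of_hasDerivAt h (hcont.intervalIntegrable _ _), ← mul_sub,
      ← Real.log_div (by positivity) (by positivity)]
    congr 2
    field_simp
    ring
  have hneg : ∫ v in (-(1 / 2) : ℝ)..0, 1 / (δ + 4 * |v|) = 1 / 4 * Real.log (1 + 2 / δ) := by
    rw [← hpos]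
    have := intervalIntegral.integral_comp_neg (a := -(1 / 2)) (b := 0)
      (fun v : ℝ => 1 / (δ + 4 * |v|))
    simpa only [abs_neg, neg_neg, neg_zero] using this
  rw [← intervalIntegral.integral_add_adjacent_intervals (hcont.intervalIntegrable _ _)
    (hcont.intervalIntegrable _ _), hpos, hneg]
  ring

lemma four_mul_abs_le_norm_one_sub_nome {v : ℝ} (hv : |v| ≤ 1 / 2) :
    4 * |v| ≤ ‖1 - nome v‖ := by
  have h : nome v = Complex.exp (Complex.I * ((2 * Real.pi * v : ℝ) : ℂ)) := by
    rw [nome]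
    congr 1
    push_cast
    ring
  have hpi := Real.pi_pos
  rw [norm_sub_rev, h, Complex.norm_exp_I_mul_ofReal_sub_one, norm_mul, Real.norm_eq_abs,
    Real.norm_eq_abs, abs_two, show 2 * Real.pi * v / 2 = Real.pi * v by ring]
  have := Real.mul_abs_le_abs_sin (x := Real.pi * v) (by
    rw [abs_mul, abs_of_pos hpi]
    nlinarith)
  rw [abs_mul, abs_of_pos hpi, ← mul_assoc, div_mul_cancel₀ _ hpi.ne'] at this
  linarith

/-- If `|u| = 1`, the point `r u` is at least half as far from `1` as `u` is. -/
lemma norm_one_sub_le_two_mul {u : ℂ} (hu : ‖u‖ = 1) {r : ℝ} (hr : 0 ≤ r) :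
    ‖1 - u‖ ≤ 2 * ‖1 - r * u‖ := by
  have h1 : |1 - r| ≤ ‖1 - r * u‖ := by
    simpa [hu, abs_of_nonneg hr] using abs_norm_sub_norm_le (1 : ℂ) (r * u)
  have h2 : ‖1 - u‖ ≤ ‖1 - r * u‖ + ‖(r - 1) * u‖ := by
    rw [show 1 - u = (1 - r * u) + (r - 1) * u by ring]
    exact norm_add_le _ _
  have h3 : ‖((r : ℂ) - 1) * u‖ = |1 - r| := by
    rw [norm_mul, hu, mul_one, abs_sub_comm, ← Real.norm_eq_abs, ← Complex.norm_real]
    simp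
  linarith

lemma le_norm_one_sub_nome {h v δ : ℝ} (hδ : δ ≤ |1 - Real.exp (-2 * Real.pi * h)|)
    (hv : |v| ≤ 1 / 2) : δ + 4 * |v| ≤ 3 * ‖1 - nome (h * Complex.I - v)‖ := by
  have hn : ‖nome (h * Complex.I - v)‖ = Real.exp (-2 * Real.pi * h) := by simp [norm_nome]
  have h1 : |1 - Real.exp (-2 * Real.pi * h)| ≤ ‖1 - nome (h * Complex.I - v)‖ := by
    simpa [hn] using abs_norm_sub_norm_le (1 : ℂ) (nome (h * Complex.I - v))
  have h2 := norm_one_sub_le_two_mul (u := nome ((-v : ℝ) : ℂ)) (by simp [norm_nome])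
    (Real.exp_pos (-2 * Real.pi * h)).le
  have h3 : nome (h * Complex.I - v) =
      (Real.exp (-2 * Real.pi * h) : ℂ) * nome ((-v : ℝ) : ℂ) := by
    rw [nome, nome, Complex.ofReal_exp, ← Complex.exp_add]
    congr 1
    push_cast
    linear_combination (2 * Real.pi * h : ℂ) * Complex.I_sq
  have h4 := four_mul_abs_le_norm_one_sub_nome (v := -v) (by rwa [abs_neg])
  rw [← h3] at h2
  rw [abs_neg] at h4
  linarith

/-- Bound for a block of the series at height `z.im`, obtained from the sup norm of the sum at
height `t` and an `L¹` bound for the geometric kernel. -/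
lemma norm_sum_Ico_le {a : ℕ → ℂ} {C α : ℝ}
    (ha : ∀ n : ℕ, 1 ≤ n → ‖a n‖ ≤ C * (n : ℝ) ^ α) {t B δ : ℝ} (ht : 0 < t)
    (hB : ∀ x : ℝ, ‖cuspSum a (x + t * Complex.I)‖ ≤ B) (z : ℂ) (hδ : 0 < δ)
    (hδr : δ ≤ |1 - Real.exp (-2 * Real.pi * (z.im - t))|) {L N : ℕ} (hL : 1 ≤ L) (hLN : L ≤ N) :
    ‖∑ m ∈ Finset.Ico L N, a m * nome z ^ m‖ ≤
      3 / 2 * B * (Real.exp (-2 * Real.pi * (z.im - t)) ^ L +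
        Real.exp (-2 * Real.pi * (z.im - t)) ^ N) * Real.log (1 + 2 / δ) := by
  set r := Real.exp (-2 * Real.pi * (z.im - t)) with hr
  set s : ℂ := z.re + t * Complex.I with hs
  set w : ℂ := ((z.im - t : ℝ) : ℂ) * Complex.I with hw
  have hs0 : 0 < s.im := by simpa [hs] using ht
  have hsw : s + w = z := by
    rw [hs, hw]
    push_cast
    linear_combination Complex.re_add_im z
  have hcont (m : ℕ) : Continuous fun v : ℝ => cuspSum a (s + v) * nome (w - v) ^ m :=
    (continuous_cuspSum_add_ofReal ha hs0).mul ((continuous_nome.comp (by fun_prop)).pow _)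
  have hB0 : 0 ≤ B := (norm_nonneg _).trans (hB 0)
  have hrep : ∑ m ∈ Finset.Ico L N, a m * nome z ^ m =
      ∫ v in (-(1 / 2) : ℝ)..(1 / 2),
        ∑ m ∈ Finset.Ico L N, cuspSum a (s + v) * nome (w - v) ^ m := by
    rw [intervalIntegral.integral_finsetSum fun m _ => (hcont m).intervalIntegrable _ _]
    refine Finset.sum_congr rfl fun m hm => ?_
    rw [integral_cuspSum_mul_nome_pow ha hs0 w (hL.trans (Finset.mem_Ico.1 hm).1), hsw]
  have hbound (v : ℝ) (hv : v ∈ Set.Ioc (-(1 / 2) : ℝ) (1 / 2)) :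
      ‖∑ m ∈ Finset.Ico L N, cuspSum a (s + v) * nome (w - v) ^ m‖ ≤
        3 * B * (r ^ L + r ^ N) * (1 / (δ + 4 * |v|)) := by
    have hv' : |v| ≤ 1 / 2 := abs_le.2 ⟨hv.1.le, hv.2⟩
    have hlow := le_norm_one_sub_nome hδr hv'
    rw [← hw] at hlow
    have hden : 0 < δ + 4 * |v| := by positivity
    have hne : nome (w - v) ≠ 1 := by
      intro h
      simp only [h, sub_self, norm_zero] at hlow
      linarith
    have hn : ‖nome (w - v)‖ = r := by simp [norm_nome, hw, hr]
    rw [← Finset.mul_sum, geom_sum_Ico' hne hLN, norm_mul, norm_div]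
    have h1 : ‖cuspSum a (s + v)‖ ≤ B := by
      convert hB (z.re + v) using 3
      rw [hs]
      push_cast
      ring
    have h2 : ‖nome (w - v) ^ L - nome (w - v) ^ N‖ ≤ r ^ L + r ^ N := by
      simpa only [norm_pow, hn] using norm_sub_le (nome (w - v) ^ L) (nome (w - v) ^ N)
    have hr0 : 0 ≤ r ^ L + r ^ N := by positivity
    calc _ ≤ B * ((r ^ L + r ^ N) / ((δ + 4 * |v|) / 3)) := by
          gcongr
          linarith
      _ = _ := by field_simp
  rw [hrep]
  refine (intervalIntegral.norm_integral_le_of_norm_le (by norm_num) (.of_forall hbound) ?_).trans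
    (le_of_eq ?_)
  · refine Continuous.intervalIntegrable ?_ _ _
    exact continuous_const.mul (continuous_const.div (by fun_prop) fun v => by positivity)
  · rw [intervalIntegral.integral_const_mul, integral_one_div_add_abs hδ]
    ring

lemma log_le_four_mul_log {x M : ℝ} (hM : 2 ≤ M) (hx : 0 < x) (hxM : x ≤ 4 * M + 3) :
    Real.log x ≤ 4 * Real.log M := by
  rw [show 4 * Real.log M = Real.log (M ^ 4) by simp [Real.log_pow]]
  refine Real.log_le_log hx (hxM.trans ?_)
  nlinarith [sq_nonneg (M ^ 2 - 4), sq_nonneg (M - 2)]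

/-- Bound for the partial sum at heights `z.im ≤ 1 / (2πM)`. -/
lemma norm_partial_sum_le {a : ℕ → ℂ} {C α κ A : ℝ}
    (ha : ∀ n : ℕ, 1 ≤ n → ‖a n‖ ≤ C * (n : ℝ) ^ α)
    (hf : ∀ x y : ℝ, 0 < y → ‖cuspSum a (x + y * Complex.I)‖ ≤ A * y ^ (-κ))
    {M : ℕ} (hM : 2 ≤ M) {z : ℂ} (hz : 0 < z.im) (hzM : z.im ≤ 1 / (2 * Real.pi * M)) :
    ‖∑ m ∈ Finset.Icc 1 M, a m * nome z ^ m‖ ≤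
      12 * A * Real.exp (3 * Real.pi + 3 / 2) *
        Real.exp (-2 * Real.pi * z.im * (M + 1)) * (M : ℝ) ^ κ * Real.log M := by
  have hpi := Real.pi_gt_three
  have hM' : (2 : ℝ) ≤ M := by exact_mod_cast hM
  have hM0 : (0 : ℝ) < M := by linarith
  have hA : 0 ≤ A := by simpa using (norm_nonneg _).trans (hf 0 1 one_pos)
  have hyM : 2 * Real.pi * z.im * M ≤ 1 := by
    rw [le_div_iff₀ (by positivity)] at hzM
    linarith
  have hinv : (M : ℝ) * (1 / M) = 1 := by field_simp
  have hexp : 1 / (M : ℝ) ≤ -2 * Real.pi * (z.im - 1 / M) := by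
    refine le_of_mul_le_mul_left ?_ hM0
    nlinarith
  have hδr : 1 / (M : ℝ) ≤ |1 - Real.exp (-2 * Real.pi * (z.im - 1 / M))| := by
    rw [abs_sub_comm]
    refine le_trans ?_ (le_abs_self _)
    linarith [Real.add_one_le_exp (-2 * Real.pi * (z.im - 1 / M))]
  have hmain := norm_sum_Ico_le ha (t := 1 / (M : ℝ)) (by positivity)
    (fun x => hf x _ (by positivity)) z (by positivity) hδr le_rfl (show 1 ≤ M + 1 by omega)
  have hIco : Finset.Ico 1 (M + 1) = Finset.Icc 1 M := by
    ext
    simp only [Finset.mem_Ico, Finset.mem_Icc]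
    omega
  rw [hIco] at hmain
  have hpow (j : ℕ) (hj : j ≤ M + 1) :
      Real.exp (-2 * Real.pi * (z.im - 1 / M)) ^ j ≤ Real.exp (3 * Real.pi) := by
    rw [← Real.exp_nat_mul, Real.exp_le_exp]
    have hj' : (j : ℝ) ≤ M + 1 := by exact_mod_cast hj
    have h0 : 0 ≤ -2 * Real.pi * (z.im - 1 / M) := le_trans (by positivity) hexp
    have h1 : (1 : ℝ) / M ≤ 1 / 2 := one_div_le_one_div_of_le two_pos hM'
    have h2 : 0 ≤ 2 * Real.pi * z.im * (M + 1) := by positivity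
    calc _ ≤ ((M : ℝ) + 1) * (-2 * Real.pi * (z.im - 1 / M)) := by gcongr
      _ ≤ _ := by nlinarith
  have hlog : Real.log (1 + 2 / (1 / (M : ℝ))) ≤ 4 * Real.log M := by
    refine log_le_four_mul_log hM' (by positivity) ?_
    rw [div_div_eq_mul_div, div_one]
    linarith
  have hlog0 : 0 ≤ Real.log M := Real.log_nonneg (by linarith)
  have hexp1 : 1 ≤ Real.exp (3 / 2) * Real.exp (-2 * Real.pi * z.im * (M + 1)) := by
    rw [← Real.exp_add, Real.one_le_exp_iff]
    nlinarith
  have hpk : (1 / (M : ℝ)) ^ (-κ) = (M : ℝ) ^ κ := by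
    rw [one_div, Real.inv_rpow hM0.le, Real.rpow_neg hM0.le, inv_inv]
  rw [hpk] at hmain
  calc _ ≤ _ := hmain
    _ ≤ 3 / 2 * (A * (M : ℝ) ^ κ) * (Real.exp (3 * Real.pi) + Real.exp (3 * Real.pi)) *
        (4 * Real.log M) := by
      gcongr
      · exact Real.log_nonneg (le_add_of_nonneg_right (by positivity))
      · exact hpow 1 (by omega)
      · exact hpow _ le_rfl
    _ = 12 * A * Real.exp (3 * Real.pi) * (M : ℝ) ^ κ * Real.log M * 1 := by ring
    _ ≤ 12 * A * Real.exp (3 * Real.pi) * (M : ℝ) ^ κ * Real.log M *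
        (Real.exp (3 / 2) * Real.exp (-2 * Real.pi * z.im * (M + 1))) := by gcongr
    _ = _ := by
      rw [Real.exp_add]
      ring

/-- Bound for the tail of the series at heights `z.im > 1 / (2πM)`. -/
lemma norm_partial_sum_sub_cuspSum_le {a : ℕ → ℂ} {C α κ A : ℝ}
    (ha : ∀ n : ℕ, 1 ≤ n → ‖a n‖ ≤ C * (n : ℝ) ^ α)
    (hf : ∀ x y : ℝ, 0 < y → ‖cuspSum a (x + y * Complex.I)‖ ≤ A * y ^ (-κ))
    {M : ℕ} (hM : 2 ≤ M) {z : ℂ} (hzM : 1 / (2 * Real.pi * M) < z.im) :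
    ‖∑ m ∈ Finset.Icc 1 M, a m * nome z ^ m - cuspSum a z‖ ≤
      12 * A * (4 * Real.pi) ^ κ * Real.exp 1 *
        Real.exp (-2 * Real.pi * z.im * (M + 1)) * (M : ℝ) ^ κ * Real.log M := by
  have hpi := Real.pi_pos
  have hM' : (2 : ℝ) ≤ M := by exact_mod_cast hM
  have hM0 : (0 : ℝ) < M := by linarith
  have hz : 0 < z.im := lt_trans (by positivity) hzM
  have hA : 0 ≤ A := by simpa using (norm_nonneg _).trans (hf 0 1 one_pos)
  have hlog0 : 0 ≤ Real.log M := Real.log_nonneg (by linarith)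
  set t : ℝ := 1 / (4 * Real.pi * M) with ht
  have ht0 : 0 < t := by positivity
  have htM : 4 * Real.pi * t * M = 1 := by
    rw [ht]
    field_simp
  have htz : 2 * t < z.im := by
    convert hzM using 1
    rw [ht]
    field_simp
    norm_num
  set r := Real.exp (-2 * Real.pi * (z.im - t)) with hr
  have hr0 : 0 < r := Real.exp_pos _
  have hr1 : r ≤ 1 := by
    rw [hr, Real.exp_le_one_iff]
    nlinarith [mul_pos hpi ht0]
  have hδr : 1 / (2 * M + 1 : ℝ) ≤ |1 - r| := by
    rw [abs_of_nonneg (by linarith)]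
    have h1 : 1 + 1 / (2 * M : ℝ) ≤ r⁻¹ := by
      rw [hr, ← Real.exp_neg]
      refine le_trans ?_ (Real.add_one_le_exp _)
      have : 1 / (2 * M : ℝ) = 2 * Real.pi * t := by
        rw [ht]
        field_simp
        norm_num
      rw [this]
      nlinarith
    have h2 : r ≤ (1 + 1 / (2 * M : ℝ))⁻¹ := (le_inv_comm₀ hr0 (by positivity)).2 h1
    have h3 : 1 / (2 * M + 1 : ℝ) = 1 - (1 + 1 / (2 * M : ℝ))⁻¹ := by
      field_simp
      ring
    linarith
  have hlog : Real.log (1 + 2 / (1 / (2 * M + 1 : ℝ))) ≤ 4 * Real.log M := by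
    refine log_le_four_mul_log hM' (by positivity) ?_
    rw [div_div_eq_mul_div, div_one]
    linarith
  have hrM : r ^ (M + 1) ≤ Real.exp 1 * Real.exp (-2 * Real.pi * z.im * (M + 1)) := by
    rw [hr, ← Real.exp_nat_mul, ← Real.exp_add, Real.exp_le_exp]
    push_cast
    nlinarith [mul_pos hpi ht0]
  have hpk : t ^ (-κ) = (4 * Real.pi) ^ κ * (M : ℝ) ^ κ := by
    rw [ht, one_div, Real.inv_rpow (by positivity), Real.rpow_neg (by positivity), inv_inv,
      Real.mul_rpow (by positivity) hM0.le]
  have hblock (N : ℕ) (hN : M ≤ N) :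
      ‖∑ m ∈ Finset.Icc 1 M, a m * nome z ^ m -
          ∑ n ∈ Finset.range N, a (n + 1) * nome z ^ (n + 1)‖ ≤
        12 * A * (4 * Real.pi) ^ κ * Real.exp 1 *
          Real.exp (-2 * Real.pi * z.im * (M + 1)) * (M : ℝ) ^ κ * Real.log M := by
    have hIco : Finset.Icc 1 M = Finset.Ico 1 (M + 1) := by
      ext
      simp only [Finset.mem_Ico, Finset.mem_Icc]
      omega
    have hrange : ∑ n ∈ Finset.range N, a (n + 1) * nome z ^ (n + 1) =
        ∑ m ∈ Finset.Ico 1 (N + 1), a m * nome z ^ m := by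
      rw [Finset.range_eq_Ico, Finset.sum_Ico_add' (fun m => a m * nome z ^ m) 0 N 1, zero_add]
    rw [hIco, hrange, norm_sub_rev, ← Finset.sum_Ico_consecutive _ (show 1 ≤ M + 1 by omega)
      (show M + 1 ≤ N + 1 by omega), add_sub_cancel_left]
    refine (norm_sum_Ico_le ha ht0 (fun x => hf x t ht0) z (by positivity) hδr
      (show 1 ≤ M + 1 by omega) (show M + 1 ≤ N + 1 by omega)).trans ?_
    rw [hpk, ← hr]
    have hrN : r ^ (N + 1) ≤ r ^ (M + 1) := pow_le_pow_of_le_one hr0.le hr1 (by omega)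
    calc _ ≤ 3 / 2 * (A * ((4 * Real.pi) ^ κ * (M : ℝ) ^ κ)) *
          (Real.exp 1 * Real.exp (-2 * Real.pi * z.im * (M + 1)) +
            Real.exp 1 * Real.exp (-2 * Real.pi * z.im * (M + 1))) * (4 * Real.log M) := by
          gcongr
          · exact Real.log_nonneg (le_add_of_nonneg_right (by positivity))
          · exact hrN.trans hrM
      _ = _ := by ring
  have hsummable : Summable fun n : ℕ => a (n + 1) * nome z ^ (n + 1) :=
    .of_norm <| by
      simpa using summable_norm_mul_pow ha (norm_nonneg _) (norm_nome_lt_one hz)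
  rw [cuspSum_eq_tsum]
  exact le_of_tendsto (hsummable.hasSum.tendsto_sum_nat.const_sub _).norm
    (Filter.eventually_atTop.2 ⟨M, hblock⟩)

/-- Wilton's lemma in Lekkerkerker's form: for `f(z) = ∑ a(n) e^{2πinz}`
with polynomially bounded coefficients and uniform bound `|f(x+iy)| ≤ 𝒜 y^{−κ}`,
`|∑_{m=1}^M a(m) e^{2πimz} − δ f(z)| ≤ C' e^{−2πy(M+1)} M^κ log M`, where `δ = 0` if
`0 < y ≤ 1/(2πM)` and `δ = 1` if `y > 1/(2πM)`. -/
theorem stmt_10 (a : ℕ → ℂ) (C α : ℝ) (hC : 0 < C) (hα : 0 < α)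
    (ha : ∀ n : ℕ, 1 ≤ n → norm (a n) ≤ C * (n : ℝ) ^ α)
    (κ : ℝ) (hκ : 0 < κ) (𝒜 : ℝ)
    (hf : ∀ x y : ℝ, 0 < y →
      norm (cuspSum a ((x : ℂ) + (y : ℂ) * Complex.I)) ≤ 𝒜 * y ^ (-κ)) :
    ∃ C' > (0 : ℝ), ∀ M : ℕ, 2 ≤ M → ∀ z : ℂ, 0 < z.im →
      norm
          ((∑ m ∈ Finset.Icc 1 M, a m * Complex.exp (2 * Real.pi * Complex.I * (m : ℂ) * z)) -
            (if z.im ≤ 1 / (2 * Real.pi * M) then (0 : ℂ) else 1) * cuspSum a z) ≤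
        C' * Real.exp (-2 * Real.pi * z.im * ((M : ℝ) + 1)) * (M : ℝ) ^ κ * Real.log M := by
  have hA : 0 ≤ 𝒜 := by simpa using (norm_nonneg _).trans (hf 0 1 one_pos)
  set K₁ := 12 * 𝒜 * Real.exp (3 * Real.pi + 3 / 2) with hK₁
  set K₂ := 12 * 𝒜 * (4 * Real.pi) ^ κ * Real.exp 1 with hK₂
  have hK₁0 : 0 ≤ K₁ := by positivity
  have hK₂0 : 0 ≤ K₂ := by positivity
  refine ⟨K₁ + K₂ + 1, by positivity, fun M hM z hz => ?_⟩
  have hlog : 0 ≤ Real.log M := Real.log_natCast_nonneg M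
  simp only [← nome_pow]
  split_ifs with h
  · rw [zero_mul, sub_zero]
    refine (norm_partial_sum_le ha hf hM hz h).trans ?_
    rw [← hK₁]
    gcongr
    linarith
  · rw [one_mul]
    refine (norm_partial_sum_sub_cuspSum_le ha hf hM (not_le.1 h)).trans ?_
    rw [← hK₂]
    gcongr
    linarith
end

section
/- Let a : ℕ → ℂ satisfy |a(n)| ≤ C n^α for some C, α > 0, and let c ≥ 1 be the smallest positive integer with a(c) ≠ 0. Then for every s ∈ ℂ with Re(s) > α + 1, both sides below converge absolutely and ∫₀^{∞} ( ∑_{n=c+1}^{∞} a(n) (n/c)^{−(s+t)} ) dt = ∑_{n=c+1}^{∞} a(n) / (log(n/c)) · (n/c)^{−s}. -/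
/-- A general Dirichlet series on the real line with absolutely summable coefficients `d` and
frequencies bounded below by `δ > 0` is integrable on `(0, ∞)` and may be integrated termwise. -/
theorem integral_tsum_mul_exp_neg {d : ℕ → ℂ} {l : ℕ → ℝ} {δ : ℝ} (hδ : 0 < δ)
    (hl : ∀ n, δ ≤ l n) (hd : Summable fun n => ‖d n‖) :
    (∀ t : ℝ, 0 ≤ t → Summable fun n => ‖d n * Complex.exp (-(l n : ℂ) * t)‖) ∧
    MeasureTheory.IntegrableOn (fun t : ℝ => ∑' n, d n * Complex.exp (-(l n : ℂ) * t))
      (Set.Ioi 0) ∧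
    (Summable fun n => ‖d n / (l n : ℂ)‖) ∧
    ∫ t in Set.Ioi (0 : ℝ), ∑' n, d n * Complex.exp (-(l n : ℂ) * t) =
      ∑' n, d n / (l n : ℂ) := by
  have hl0 : ∀ n, 0 < l n := fun n => hδ.trans_le (hl n)
  have hre : ∀ n, (-(l n : ℂ)).re < 0 := fun n => by simpa using hl0 n
  have hnorm : ∀ n (t : ℝ), ‖d n * Complex.exp (-(l n : ℂ) * t)‖
      = ‖d n‖ * Real.exp (-(l n) * t) := fun n t => by
    rw [norm_mul, Complex.norm_exp]
    simp
  have hbound : ∀ n (t : ℝ), 0 ≤ t → ‖d n * Complex.exp (-(l n : ℂ) * t)‖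
      ≤ ‖d n‖ * Real.exp (-δ * t) := fun n t ht => by
    rw [hnorm]
    gcongr
    exact hl n
  have hbound' : ∀ n (t : ℝ), 0 ≤ t → ‖d n * Complex.exp (-(l n : ℂ) * t)‖ ≤ ‖d n‖ :=
    fun n t ht => (hbound n t ht).trans <| mul_le_of_le_one_right (norm_nonneg _) <|
      Real.exp_le_one_iff.2 (by nlinarith)
  have hsum : ∀ t : ℝ, 0 ≤ t → Summable fun n => ‖d n * Complex.exp (-(l n : ℂ) * t)‖ :=
    fun t ht => hd.of_nonneg_of_le (fun _ => norm_nonneg _) fun n => hbound' n t ht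
  have hdiv : Summable fun n => ‖d n / (l n : ℂ)‖ := by
    refine (hd.div_const δ).of_nonneg_of_le (fun _ => norm_nonneg _) fun n => ?_
    rw [norm_div, Complex.norm_real, Real.norm_of_nonneg (hl0 n).le]
    gcongr
    exact hl n
  have hcont : ContinuousOn (fun t : ℝ => ∑' n, d n * Complex.exp (-(l n : ℂ) * t))
      (Set.Ioi 0) :=
    continuousOn_tsum (fun n => by fun_prop) hd fun n t ht => hbound' n t (le_of_lt ht)
  refine ⟨hsum, ?_, hdiv, ?_⟩
  · refine MeasureTheory.Integrable.mono'
      ((integrableOn_exp_mul_Ioi (neg_lt_zero.2 hδ) 0).const_mul (∑' n, ‖d n‖))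
      (hcont.aestronglyMeasurable measurableSet_Ioi) ?_
    refine (MeasureTheory.ae_restrict_mem measurableSet_Ioi).mono fun t ht => ?_
    rw [← tsum_mul_right]
    exact (norm_tsum_le_tsum_norm (hsum t (le_of_lt ht))).trans <|
      (hsum t (le_of_lt ht)).tsum_le_tsum (fun n => hbound n t (le_of_lt ht)) (hd.mul_right _)
  · rw [← MeasureTheory.integral_tsum_of_summable_integral_norm]
    · refine tsum_congr fun n => ?_
      rw [MeasureTheory.integral_const_mul, integral_exp_mul_complex_Ioi (hre n)]
      simp [div_eq_mul_inv]
    · exact fun n => (integrableOn_exp_mul_complex_Ioi (hre n) 0).const_mul (d n)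
    · refine hdiv.congr fun n => ?_
      simp_rw [hnorm]
      rw [MeasureTheory.integral_const_mul, integral_exp_mul_Ioi (neg_lt_zero.2 (hl0 n)), norm_div,
        Complex.norm_real, Real.norm_of_nonneg (hl0 n).le]
      simp [div_eq_mul_inv]

/-- for `Re(s) > α + 1`,
`∫₀^∞ (∑_{n>c} a(n) (n/c)^{−(s+t)}) dt = ∑_{n>c} a(n)/log(n/c) · (n/c)^{−s}`,
both sides converging absolutely. -/
theorem stmt_13 (a : ℕ → ℂ) (C α : ℝ) (hC : 0 < C) (hα : 0 < α)
    (ha : ∀ n : ℕ, 1 ≤ n → ‖a n‖ ≤ C * (n : ℝ) ^ α)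
    (c : ℕ) (hc : 1 ≤ c) (hac : a c ≠ 0)
    (hmin : ∀ m : ℕ, 1 ≤ m → m < c → a m = 0)
    (s : ℂ) (hs : α + 1 < s.re) :
    (∀ t : ℝ, 0 ≤ t →
      Summable (fun n : ℕ =>
        ‖a (n + c + 1) *
          (((((n : ℝ) + (c : ℝ) + 1) / (c : ℝ)) : ℝ) : ℂ) ^ (-(s + (t : ℂ)))‖)) ∧
    MeasureTheory.IntegrableOn
      (fun t : ℝ => ∑' n : ℕ, a (n + c + 1) *
        (((((n : ℝ) + (c : ℝ) + 1) / (c : ℝ)) : ℝ) : ℂ) ^ (-(s + (t : ℂ))))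
      (Set.Ioi 0) ∧
    Summable (fun n : ℕ =>
      ‖a (n + c + 1) / (Real.log (((n : ℝ) + (c : ℝ) + 1) / (c : ℝ)) : ℂ) *
        (((((n : ℝ) + (c : ℝ) + 1) / (c : ℝ)) : ℝ) : ℂ) ^ (-s)‖) ∧
    (∫ t in Set.Ioi (0 : ℝ), ∑' n : ℕ, a (n + c + 1) *
        (((((n : ℝ) + (c : ℝ) + 1) / (c : ℝ)) : ℝ) : ℂ) ^ (-(s + (t : ℂ)))) =
      ∑' n : ℕ, a (n + c + 1) / (Real.log (((n : ℝ) + (c : ℝ) + 1) / (c : ℝ)) : ℂ) *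
        (((((n : ℝ) + (c : ℝ) + 1) / (c : ℝ)) : ℝ) : ℂ) ^ (-s) := by
  have hc0 : (0 : ℝ) < c := by exact_mod_cast hc
  set x : ℕ → ℝ := fun n => ((n : ℝ) + c + 1) / c with hx
  have hx1 : ∀ n, ((c : ℝ) + 1) / c ≤ x n := fun n => by
    simp only [hx]
    gcongr
    linarith [Nat.cast_nonneg (α := ℝ) n]
  have hone : 1 < ((c : ℝ) + 1) / c := by rw [one_lt_div hc0]; linarith
  have hx0 : ∀ n, 0 < x n := fun n => by linarith [hx1 n]
  have hterm : ∀ n (t : ℝ), a (n + c + 1) * (x n : ℂ) ^ (-(s + (t : ℂ))) =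
      a (n + c + 1) * (x n : ℂ) ^ (-s) * Complex.exp (-(Real.log (x n) : ℂ) * t) := fun n t => by
    have h : (x n : ℂ) ≠ 0 := by exact_mod_cast (hx0 n).ne'
    rw [neg_add, Complex.cpow_add _ _ h, Complex.cpow_def_of_ne_zero h (-(t : ℂ)),
      ← Complex.ofReal_log (hx0 n).le, mul_assoc, mul_neg, neg_mul]
  have hd : Summable fun n => ‖a (n + c + 1) * (x n : ℂ) ^ (-s)‖ := by
    have hp : Summable fun n : ℕ => (n : ℝ) ^ (α - s.re) := Real.summable_nat_rpow.2 (by linarith)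
    have hq := ((summable_nat_add_iff (c + 1)).2 hp).mul_left (C * (c : ℝ) ^ s.re)
    refine hq.of_nonneg_of_le (fun _ => norm_nonneg _) fun n => ?_
    have hn : (0 : ℝ) < (n : ℝ) + c + 1 := by positivity
    have han := ha (n + c + 1) (by omega)
    rw [norm_mul, Complex.norm_cpow_eq_rpow_re_of_pos (hx0 n), Complex.neg_re]
    push_cast at han ⊢
    have hxn : x n ^ (-s.re) = (c : ℝ) ^ s.re * ((n : ℝ) + c + 1) ^ (-s.re) := by
      simp only [hx]
      rw [Real.div_rpow hn.le hc0.le, Real.rpow_neg hc0.le, div_inv_eq_mul, mul_comm]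
    rw [hxn, ← add_assoc, sub_eq_add_neg, Real.rpow_add hn]
    calc _ ≤ C * ((n : ℝ) + c + 1) ^ α * ((c : ℝ) ^ s.re * ((n : ℝ) + c + 1) ^ (-s.re)) := by
          gcongr
      _ = _ := by ring
  have hdiv : ∀ n, a (n + c + 1) / (Real.log (x n) : ℂ) * (x n : ℂ) ^ (-s) =
      a (n + c + 1) * (x n : ℂ) ^ (-s) / (Real.log (x n) : ℂ) := fun n => by ring
  have key := integral_tsum_mul_exp_neg (l := fun n => Real.log (x n)) (Real.log_pos hone)
    (fun n => Real.log_le_log (by linarith) (hx1 n)) hd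
  simp_rw [← hterm, ← hdiv] at key
  exact key
end
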